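/- arXiv:1704.01385 — 6 statements merged into one kernel-verified Lean document; each statement's English description precedes it below -/
import Mathlib

section
/- Let m > 0. There exists a constant C > 0, depending only on m, such that for every open set Ω ⊆ ℝ² whose Lebesgue measure is at most m, every real number α with 0 < α ≤ 4π, and every continuously differentiable function u : ℝ² → ℝ with compact support contained in Ω satisfying ∫_{ℝ²} ‖∇u(x)‖² dx ≤ 1, one has ∫_Ω e^{α u(x)²} dx ≤ C. -/
open Real MeasureTheory
open scoped ENNReal NNReal

open Pointwise in
/-- One-dimensional Brunn–Minkowski inequality for compact sets. -/
lemma volume_add_volume_le_of_isCompact {K L : Set ℝ} (hK : IsCompact K) (hL : IsCompact L)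
    (hKn : K.Nonempty) (hLn : L.Nonempty) : volume K + volume L ≤ volume (K + L) := by
  set k := sSup K
  set l := sInf L
  have hk : k ∈ K := hK.sSup_mem hKn
  have hl : l ∈ L := hL.sInf_mem hLn
  have hd : AEDisjoint volume ((fun x => l + x) '' K) ((fun x => k + x) '' L) := by
    refine measure_mono_null (t := {k + l}) ?_ (by simp)
    rintro _ ⟨⟨x, hx, rfl⟩, ⟨y, hy, hxy⟩⟩
    have h1 : x ≤ k := le_csSup hK.bddAbove hx
    have h2 : l ≤ y := csInf_le hL.bddBelow hy
    have : k + y = l + x := hxy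
    simp only [Set.mem_singleton_iff]
    linarith
  have hm : MeasurableSet ((fun x => k + x) '' L) :=
    (hL.image (by fun_prop)).measurableSet
  have h1 : volume ((fun x => l + x) '' K) = volume K := by
    simp
  have h2 : volume ((fun x => k + x) '' L) = volume L := by
    simp
  rw [← h1, ← h2, ← measure_union₀ hm.nullMeasurableSet hd]
  refine measure_mono (Set.union_subset ?_ ?_)
  · rintro _ ⟨x, hx, rfl⟩
    exact ⟨x, hx, l, hl, add_comm _ _⟩
  · rintro _ ⟨x, hx, rfl⟩
    exact ⟨k, hk, x, hx, rfl⟩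

open Pointwise in
/-- One-dimensional Brunn–Minkowski inequality. -/
lemma volume_add_volume_le {A B : Set ℝ} (hA : MeasurableSet A) (hB : MeasurableSet B)
    (hAn : A.Nonempty) (hBn : B.Nonempty) : volume A + volume B ≤ volume (A + B) := by
  obtain ⟨a, ha⟩ := hAn
  obtain ⟨b, hb⟩ := hBn
  rw [hA.measure_eq_iSup_isCompact, hB.measure_eq_iSup_isCompact]
  simp only [iSup_and']
  refine ENNReal.biSup_add_biSup_le (s := {K | K ⊆ A ∧ IsCompact K})
    (t := {K | K ⊆ B ∧ IsCompact K}) ⟨∅, by simp⟩ ⟨∅, by simp⟩ ?_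
  rintro K ⟨hKA, hK⟩ L ⟨hLB, hL⟩
  calc volume K + volume L ≤ volume (insert a K) + volume (insert b L) := by
        gcongr <;> exact Set.subset_insert _ _
    _ ≤ volume (insert a K + insert b L) :=
        volume_add_volume_le_of_isCompact (hK.insert a) (hL.insert b)
          (Set.insert_nonempty _ _) (Set.insert_nonempty _ _)
    _ ≤ volume (A + B) :=
        measure_mono (Set.add_subset_add (Set.insert_subset ha hKA) (Set.insert_subset hb hLB))

/-- Normalized layer-cake formula for a function truncated at height `F`. -/
lemma lintegral_min_eq_mul_lintegral_meas_lt {f : ℝ → ℝ≥0∞} (hf : Measurable f) {F : ℝ}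
    (hF : 0 < F) :
    ∫⁻ x, min (f x) (ENNReal.ofReal F) =
      ENNReal.ofReal F * ∫⁻ θ in Set.Ioo (0 : ℝ) 1, volume {x | ENNReal.ofReal (θ * F) < f x} := by
  have hfin : ∀ x, min (f x) (ENNReal.ofReal F) ≠ ∞ := fun x =>
    ne_top_of_le_ne_top ENNReal.ofReal_ne_top (min_le_right _ _)
  set g : ℝ → ℝ := fun x => (min (f x) (ENNReal.ofReal F)).toReal / F with hg
  have hgm : Measurable g := by fun_prop
  have hg0 : ∀ x, 0 ≤ g x := fun x => by positivity
  have h1 : ∀ x, min (f x) (ENNReal.ofReal F) = ENNReal.ofReal F * ENNReal.ofReal (g x) := by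
    intro x
    rw [← ENNReal.ofReal_mul hF.le, hg]
    simp only
    rw [mul_div_cancel₀ _ hF.ne', ENNReal.ofReal_toReal (hfin x)]
  simp_rw [h1]
  rw [lintegral_const_mul _ (by fun_prop),
    lintegral_eq_lintegral_meas_lt volume (Filter.Eventually.of_forall hg0) hgm.aemeasurable]
  congr 1
  have hg1 : ∀ x, g x ≤ 1 := by
    intro x
    rw [hg]
    simp only
    rw [div_le_one hF]
    exact ENNReal.toReal_le_of_le_ofReal hF.le (min_le_right _ _)
  have hsub : Set.Ioo (0 : ℝ) 1 ⊆ Set.Ioi 0 := fun x hx => hx.1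
  rw [← lintegral_inter_add_sdiff _ (Set.Ioi 0) (measurableSet_Ioo (a := (0 : ℝ)) (b := 1)),
    Set.inter_eq_right.2 hsub, setLIntegral_congr_fun (g := 0)
    (measurableSet_Ioi.diff measurableSet_Ioo) (s := Set.Ioi (0 : ℝ) \ Set.Ioo 0 1)]
  · simp only [Pi.zero_apply, lintegral_zero, add_zero]
    refine setLIntegral_congr_fun measurableSet_Ioo ?_
    intro θ hθ
    simp only
    congr 1
    ext x
    simp only [Set.mem_ofPred_eq, hg]
    rw [lt_div_iff₀ hF, ← ENNReal.ofReal_lt_iff_lt_toReal (by have := hθ.1; positivity) (hfin x),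
      lt_min_iff]
    refine and_iff_left ?_
    rw [ENNReal.ofReal_lt_ofReal_iff hF]
    nlinarith [hθ.2]
  · rintro θ ⟨hθ0, hθ⟩
    have : 1 ≤ θ := by
      by_contra! h
      exact hθ ⟨hθ0, h⟩
    have : {a | θ < g a} = ∅ := by
      ext x
      simp only [Set.mem_ofPred_eq, Set.mem_empty_iff_false, iff_false, not_lt]
      exact (hg1 x).trans this
    simp only [this, measure_empty, Pi.zero_apply]

open Pointwise in
/-- Two-dimensional Brunn–Minkowski inequality, for measurable sets with bounded sections. -/
lemma volume_add_volume_add_sqrt_le_prod {A B C : Set (ℝ × ℝ)} (hA : MeasurableSet A)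
    (hB : MeasurableSet B) (hC : MeasurableSet C) (hABC : A + B ⊆ C)
    (hA0 : volume A ≠ 0) (hB0 : volume B ≠ 0) (hAt : volume A ≠ ∞) (hBt : volume B ≠ ∞)
    (hAs : ⨆ x, volume (Prod.mk x ⁻¹' A) ≠ ∞) (hBs : ⨆ x, volume (Prod.mk x ⁻¹' B) ≠ ∞) :
    volume A + volume B + ENNReal.ofReal (2 * √((volume A).toReal * (volume B).toReal)) ≤
      volume C := by
  have key : ∀ S : Set (ℝ × ℝ), MeasurableSet S →
      volume S = ∫⁻ x, volume (Prod.mk x ⁻¹' S) := fun S hS => by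
    rw [Measure.volume_eq_prod, Measure.prod_apply hS]
  have hpos : ∀ S : Set (ℝ × ℝ), MeasurableSet S → volume S ≠ 0 →
      (⨆ x, volume (Prod.mk x ⁻¹' S)) ≠ ∞ →
      0 < (⨆ x, volume (Prod.mk x ⁻¹' S)).toReal := by
    intro S hS hS0 hSt
    refine ENNReal.toReal_pos ?_ hSt
    intro h
    apply hS0
    rw [key S hS]
    simp only [ENNReal.iSup_eq_zero] at h
    simp [h]
  set F := (⨆ x, volume (Prod.mk x ⁻¹' A)).toReal with hFdef
  set G := (⨆ x, volume (Prod.mk x ⁻¹' B)).toReal with hGdef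
  have hF : 0 < F := hpos A hA hA0 hAs
  have hG : 0 < G := hpos B hB hB0 hBs
  have hmeas : ∀ S : Set (ℝ × ℝ), MeasurableSet S →
      Measurable fun x => volume (Prod.mk x ⁻¹' S) := fun S hS => measurable_measure_prodMk_left hS
  have layer : ∀ S : Set (ℝ × ℝ), MeasurableSet S → (⨆ x, volume (Prod.mk x ⁻¹' S)) ≠ ∞ →
      0 < (⨆ x, volume (Prod.mk x ⁻¹' S)).toReal → volume S =
        ENNReal.ofReal (⨆ x, volume (Prod.mk x ⁻¹' S)).toReal * ∫⁻ θ in Set.Ioo (0 : ℝ) 1,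
          volume {x | ENNReal.ofReal (θ * (⨆ x, volume (Prod.mk x ⁻¹' S)).toReal) <
            volume (Prod.mk x ⁻¹' S)} := by
    intro S hS hSt hS0
    rw [← lintegral_min_eq_mul_lintegral_meas_lt (hmeas S hS) hS0, key S hS]
    refine lintegral_congr fun x => ?_
    rw [ENNReal.ofReal_toReal hSt, min_eq_left]
    exact le_iSup (fun x => volume (Prod.mk x ⁻¹' S)) x
  have hAl := layer A hA hAs hF
  have hBl := layer B hB hBs hG
  rw [← hFdef] at hAl
  rw [← hGdef] at hBl
  have hne : ∀ S : Set (ℝ × ℝ), (⨆ x, volume (Prod.mk x ⁻¹' S)) ≠ ∞ →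
      0 < (⨆ x, volume (Prod.mk x ⁻¹' S)).toReal → ∀ θ ∈ Set.Ioo (0 : ℝ) 1,
      {x | ENNReal.ofReal (θ * (⨆ x, volume (Prod.mk x ⁻¹' S)).toReal) <
            volume (Prod.mk x ⁻¹' S)}.Nonempty := by
    intro S hSt hS0 θ hθ
    suffices h : ENNReal.ofReal (θ * (⨆ x, volume (Prod.mk x ⁻¹' S)).toReal) <
        ⨆ x, volume (Prod.mk x ⁻¹' S) by
      obtain ⟨x, hx⟩ := lt_iSup_iff.1 h
      exact ⟨x, hx⟩
    rw [ENNReal.ofReal_lt_iff_lt_toReal (by have := hθ.1; positivity) hSt]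
    nlinarith [hθ.2]
  set IA := ∫⁻ θ in Set.Ioo (0 : ℝ) 1, volume {x | ENNReal.ofReal (θ * F) < volume (Prod.mk x ⁻¹' A)}
  set IB := ∫⁻ θ in Set.Ioo (0 : ℝ) 1, volume {x | ENNReal.ofReal (θ * G) < volume (Prod.mk x ⁻¹' B)}
  have hCl : ENNReal.ofReal (F + G) * (IA + IB) ≤ volume C := by
    calc ENNReal.ofReal (F + G) * (IA + IB)
        ≤ ENNReal.ofReal (F + G) * ∫⁻ θ in Set.Ioo (0 : ℝ) 1,
          volume {x | ENNReal.ofReal (θ * (F + G)) < volume (Prod.mk x ⁻¹' C)} := by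
          gcongr
          have hanti : Antitone fun θ : ℝ =>
              volume {x | ENNReal.ofReal (θ * F) < volume (Prod.mk x ⁻¹' A)} := by
            intro s t hst
            refine measure_mono fun x hx => ?_
            rw [Set.mem_ofPred_eq] at hx ⊢
            refine lt_of_le_of_lt ?_ hx
            gcongr
          rw [← lintegral_add_left hanti.measurable]
          refine setLIntegral_mono' measurableSet_Ioo fun θ hθ => ?_
          refine (volume_add_volume_le (measurableSet_lt measurable_const (hmeas A hA))
            (measurableSet_lt measurable_const (hmeas B hB))
            (hne A hAs hF θ hθ) (hne B hBs hG θ hθ)).trans (measure_mono ?_)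
          rintro _ ⟨x, hx, y, hy, rfl⟩
          simp only [Set.mem_ofPred_eq] at hx hy ⊢
          calc ENNReal.ofReal (θ * (F + G))
              = ENNReal.ofReal (θ * F) + ENNReal.ofReal (θ * G) := by
                have := hθ.1
                rw [mul_add, ENNReal.ofReal_add (by positivity) (by positivity)]
            _ < volume (Prod.mk x ⁻¹' A) + volume (Prod.mk y ⁻¹' B) := ENNReal.add_lt_add hx hy
            _ ≤ volume (Prod.mk x ⁻¹' A + Prod.mk y ⁻¹' B) :=
                volume_add_volume_le (measurable_prodMk_left hA) (measurable_prodMk_left hB)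
                  (nonempty_of_measure_ne_zero (zero_le.trans_lt hx).ne')
                  (nonempty_of_measure_ne_zero (zero_le.trans_lt hy).ne')
            _ ≤ volume (Prod.mk (x + y) ⁻¹' C) := by
                refine measure_mono ?_
                rintro _ ⟨s, hs, t, ht, rfl⟩
                exact hABC ⟨(x, s), hs, (y, t), ht, rfl⟩
      _ = ∫⁻ x, min (volume (Prod.mk x ⁻¹' C)) (ENNReal.ofReal (F + G)) :=
          (lintegral_min_eq_mul_lintegral_meas_lt (hmeas C hC) (by positivity)).symm
      _ ≤ volume C := by
          rw [key C hC]
          exact lintegral_mono fun x => min_le_left _ _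
  refine le_trans ?_ hCl
  have hIAt : IA ≠ ∞ := by
    intro h
    rw [hAl, h, ENNReal.mul_top (by simpa using hF)] at hAt
    exact hAt rfl
  have hIBt : IB ≠ ∞ := by
    intro h
    rw [hBl, h, ENNReal.mul_top (by simpa using hG)] at hBt
    exact hBt rfl
  rw [hAl, hBl]
  clear_value IA IB
  lift IA to ℝ≥0 using hIAt
  lift IB to ℝ≥0 using hIBt
  rw [ENNReal.toReal_mul, ENNReal.toReal_mul, ENNReal.toReal_ofReal hF.le,
    ENNReal.toReal_ofReal hG.le, ENNReal.coe_toReal, ENNReal.coe_toReal,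
    ← ENNReal.ofReal_coe_nnreal, ← ENNReal.ofReal_coe_nnreal (p := IB),
    ← ENNReal.ofReal_mul hF.le, ← ENNReal.ofReal_mul hG.le,
    ← ENNReal.ofReal_add (by positivity) (by positivity),
    ← ENNReal.ofReal_add (by positivity) (by positivity),
    ← ENNReal.ofReal_add (by positivity) (by positivity), ← ENNReal.ofReal_mul (by positivity)]
  refine ENNReal.ofReal_le_ofReal ?_
  have hsq : √(F * IA * (G * IB)) = √(F * IB) * √(G * IA) := by
    rw [← Real.sqrt_mul (by positivity)]
    congr 1
    ring
  rw [hsq]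
  nlinarith [sq_nonneg (√(F * IB) - √(G * IA)), Real.sq_sqrt (by positivity : 0 ≤ F * (IB : ℝ)),
    Real.sq_sqrt (by positivity : 0 ≤ G * (IA : ℝ))]

open Pointwise in
/-- Brunn–Minkowski inequality for the sum of a bounded open planar set and a disc. -/
lemma volume_add_le_volume_add_ball {A : Set (EuclideanSpace ℝ (Fin 2))} (hA : IsOpen A)
    (hAb : Bornology.IsBounded A) (hA0 : volume A ≠ 0) {ε : ℝ} (hε : 0 < ε) :
    volume A + ENNReal.ofReal (2 * √π * ε * √(volume A).toReal) ≤
      volume (A + Metric.ball (0 : EuclideanSpace ℝ (Fin 2)) ε) := by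
  set e : ℝ × ℝ ≃ᵐ EuclideanSpace ℝ (Fin 2) :=
    ((MeasurableEquiv.toLp 2 (Fin 2 → ℝ)).symm.trans MeasurableEquiv.finTwoArrow).symm with he
  have hmp : MeasurePreserving e volume volume :=
    (((EuclideanSpace.volume_preserving_symm_measurableEquiv_toLp (Fin 2)).trans
      (volume_preserving_finTwoArrow ℝ)).symm _)
  have hadd : ∀ p q, e (p + q) = e p + e q := by
    intro p q
    ext i
    fin_cases i <;> simp [he, MeasurableEquiv.finTwoArrow]
  have he1 : ∀ x y, (e (x, y)) 1 = y := by
    intro x y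
    simp [he, MeasurableEquiv.finTwoArrow]
  have hsec : ∀ S : Set (EuclideanSpace ℝ (Fin 2)), Bornology.IsBounded S →
      (⨆ x, volume (Prod.mk x ⁻¹' (e ⁻¹' S))) ≠ ∞ := by
    intro S hS
    obtain ⟨R, hR⟩ := hS.subset_closedBall 0
    refine ne_top_of_le_ne_top (b := ENNReal.ofReal (R - -R)) ENNReal.ofReal_ne_top
      (iSup_le fun x => ?_)
    rw [← Real.volume_Icc]
    refine measure_mono fun y hy => ?_
    have h1 : ‖e (x, y)‖ ≤ R := by simpa using hR hy
    have h2 := (PiLp.norm_apply_le (e (x, y)) 1).trans h1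
    rw [he1, Real.norm_eq_abs] at h2
    exact abs_le.1 h2
  have hvol : ∀ S : Set (EuclideanSpace ℝ (Fin 2)), volume (e ⁻¹' S) = volume S := fun S =>
    hmp.measure_preimage_equiv S
  set B := Metric.ball (0 : EuclideanSpace ℝ (Fin 2)) ε
  have hB : volume B = ENNReal.ofReal (π * ε ^ 2) := by
    rw [EuclideanSpace.volume_ball_fin_two, ← ENNReal.ofReal_pow hε.le,
      ← ENNReal.ofReal_mul (by positivity), mul_comm]
  have hAB : IsOpen (A + B) := hA.add_right
  have h := volume_add_volume_add_sqrt_le_prod (A := e ⁻¹' A) (B := e ⁻¹' B) (C := e ⁻¹' (A + B))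
    (e.measurable hA.measurableSet) (e.measurable Metric.isOpen_ball.measurableSet)
    (e.measurable hAB.measurableSet)
    (by
      rintro _ ⟨x, hx, y, hy, rfl⟩
      exact ⟨e x, hx, e y, hy, (hadd x y).symm⟩)
    (by rwa [hvol])
    (by rw [hvol, hB]; simpa using by positivity)
    (by rw [hvol]; exact hAb.measure_lt_top.ne)
    (by rw [hvol, hB]; exact ENNReal.ofReal_ne_top)
    (hsec A hAb) (hsec B Metric.isBounded_ball)
  rw [hvol, hvol, hvol] at h
  refine le_trans ?_ h
  have hs : √((volume A).toReal * (π * ε ^ 2)) = √(volume A).toReal * (√π * ε) := by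
    rw [Real.sqrt_mul (by positivity), Real.sqrt_mul (by positivity), Real.sqrt_sq hε.le]
  rw [hB, ENNReal.toReal_ofReal (by positivity), hs]
  refine add_le_add le_self_add (le_of_eq ?_)
  congr 1
  ring

section LevelSets

variable {u : EuclideanSpace ℝ (Fin 2) → ℝ}

lemma measure_lt_abs_lt_top (hc : HasCompactSupport u) {a : ℝ} (ha : 0 ≤ a) :
    volume {x | a < |u x|} < ∞ := by
  refine lt_of_le_of_lt (measure_mono fun x hx => ?_) hc.measure_lt_top
  refine subset_tsupport _ fun h0 => ?_
  rw [Set.mem_ofPred_eq, h0, abs_zero] at hx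
  linarith

lemma measurableSet_lt_abs_and_lt (hu : Continuous u) (a b : ℝ) :
    MeasurableSet {x | a < |u x| ∧ |u x| < b} :=
  (measurableSet_lt measurable_const hu.abs.measurable).inter
    (measurableSet_lt hu.abs.measurable measurable_const)

lemma exists_forall_abs_lt_add (hu : ContDiff ℝ 1 u) (hc : HasCompactSupport u) {η : ℝ}
    (hη : 0 < η) :
    ∃ ε > 0, (∀ x, ε * (‖fderiv ℝ u x‖ + η) ≤ η) ∧
      ∀ x y, dist y x < ε → |u y| < |u x| + ε * (‖fderiv ℝ u x‖ + η) := by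
  have hfc : Continuous (fderiv ℝ u) := hu.continuous_fderiv one_ne_zero
  have hfs : HasCompactSupport (fderiv ℝ u) := hc.fderiv ℝ
  obtain ⟨L, hL⟩ := hfs.exists_bound_of_continuous hfc
  have hL0 : 0 ≤ L := (norm_nonneg _).trans (hL 0)
  have huc : UniformContinuous (fderiv ℝ u) := hfs.uniformContinuous_of_continuous hfc
  obtain ⟨δ, hδ, hδu⟩ := Metric.uniformContinuous_iff.1 huc η hη
  set ε := min δ (η / (L + η)) with hεdef
  have hε : 0 < ε := by positivity
  refine ⟨ε, hε, fun x => ?_, fun x y hxy => ?_⟩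
  · calc ε * (‖fderiv ℝ u x‖ + η) ≤ η / (L + η) * (L + η) := by
          gcongr
          · exact min_le_right _ _
          · exact hL x
      _ = η := div_mul_cancel₀ _ (by positivity)
  · have hb : ∀ z ∈ Metric.ball x ε, ‖fderiv ℝ u z‖ ≤ ‖fderiv ℝ u x‖ + η := by
      intro z hz
      have h1 : dist (fderiv ℝ u z) (fderiv ℝ u x) < η :=
        hδu ((Metric.mem_ball.1 hz).trans_le (min_le_left _ _))
      rw [dist_eq_norm] at h1
      have := norm_le_norm_add_norm_sub' (fderiv ℝ u z) (fderiv ℝ u x)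
      linarith
    have h2 := (convex_ball x ε).norm_image_sub_le_of_norm_fderiv_le
      (fun z _ => (hu.differentiable one_ne_zero).differentiableAt) hb
      (Metric.mem_ball_self hε) (Metric.mem_ball.2 hxy)
    rw [Real.norm_eq_abs, ← dist_eq_norm] at h2
    have h3 := abs_sub_abs_le_abs_sub (u y) (u x)
    have h4 : (‖fderiv ℝ u x‖ + η) * dist y x < (‖fderiv ℝ u x‖ + η) * ε := by
      gcongr
    linarith

open Pointwise in
/-- Integrating the isoperimetric inequality over the levels between `a` and `b` bounds the
total variation of `u` between these levels from below. -/
lemma two_mul_sqrt_pi_mul_le_setIntegral (hu : ContDiff ℝ 1 u) (hc : HasCompactSupport u)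
    {a b : ℝ} (ha : 0 ≤ a) (hab : a < b) :
    2 * √π * (b - a) * √(volume {x | b ≤ |u x|}).toReal ≤
      ∫ x in {x | a < |u x| ∧ |u x| < b}, ‖fderiv ℝ u x‖ := by
  set β := (volume {x | b ≤ |u x|}).toReal with hβ
  set S := {x | a < |u x| ∧ |u x| < b} with hS
  have hSm : MeasurableSet S := measurableSet_lt_abs_and_lt hu.continuous a b
  have hSt : volume S ≠ ∞ := ne_top_of_le_ne_top
    (measure_lt_abs_lt_top hc ha).ne (measure_mono fun x hx => hx.1)
  have hI0 : 0 ≤ ∫ x in S, ‖fderiv ℝ u x‖ := integral_nonneg fun x => norm_nonneg _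
  have hfc : Continuous (fderiv ℝ u) := hu.continuous_fderiv one_ne_zero
  have hfi : IntegrableOn (fun x => ‖fderiv ℝ u x‖) S :=
    (hfc.norm.integrable_of_hasCompactSupport (hc.fderiv ℝ).norm).integrableOn
  rcases (show 0 ≤ β from ENNReal.toReal_nonneg).eq_or_lt with hβ0 | hβ0
  · rw [← hβ0]; simpa using hI0
  have core : ∀ η, 0 < η → η < b - a → 2 * √π * (b - a - η) * √β ≤
      (∫ x in S, ‖fderiv ℝ u x‖) + η * (volume S).toReal := by
    intro η hη hηab
    obtain ⟨ε, hε, hεη, hεu⟩ := exists_forall_abs_lt_add hu hc hη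
    have hD : ∀ t ∈ Set.Ioo (a + η) b, ENNReal.ofReal (2 * √π * ε * √β) ≤
        volume {x | |u x| ≤ t ∧ t < |u x| + ε * (‖fderiv ℝ u x‖ + η)} := by
      intro t ht
      have ht0 : 0 ≤ t := by linarith [ht.1]
      have hAt := measure_lt_abs_lt_top hc ht0
      have hβA : volume {x | b ≤ |u x|} ≤ volume {x | t < |u x|} :=
        measure_mono fun x hx => lt_of_lt_of_le ht.2 hx
      have hbm := volume_add_le_volume_add_ball (A := {x | t < |u x|})
        (isOpen_lt continuous_const hu.continuous.abs)
        (hc.isCompact.isBounded.subset fun x hx => subset_tsupport _ fun h0 => by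
          rw [Set.mem_ofPred_eq, h0, abs_zero] at hx
          linarith)
        (fun h => by
          rw [h, nonpos_iff_eq_zero] at hβA
          rw [hβ, hβA] at hβ0
          simp at hβ0) hε
      have hsub : {x | t < |u x|} + Metric.ball (0 : EuclideanSpace ℝ (Fin 2)) ε ⊆
          {x | t < |u x|} ∪ {x | |u x| ≤ t ∧ t < |u x| + ε * (‖fderiv ℝ u x‖ + η)} := by
        rintro _ ⟨y, hy, z, hz, rfl⟩
        rcases lt_or_ge t |u (y + z)| with h | h
        · exact Or.inl h
        · refine Or.inr ⟨h, lt_trans hy (hεu _ _ ?_)⟩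
          rw [dist_self_add_right]
          simpa using hz
      have h1 := hbm.trans ((measure_mono hsub).trans (measure_union_le _ _))
      refine le_trans (ENNReal.ofReal_le_ofReal ?_) ((ENNReal.add_le_add_iff_left hAt.ne).1 h1)
      gcongr
      exact ENNReal.toReal_mono hAt.ne hβA
    set W : Set (ℝ × EuclideanSpace ℝ (Fin 2)) := {p | (a + η < p.1 ∧ p.1 < b) ∧
      (|u p.2| ≤ p.1 ∧ p.1 < |u p.2| + ε * (‖fderiv ℝ u p.2‖ + η))} with hW
    have hWm : MeasurableSet W := by
      have hu2 : Continuous fun p : ℝ × EuclideanSpace ℝ (Fin 2) => |u p.2| :=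
        (hu.continuous.comp continuous_snd).abs
      have hf2 : Continuous fun p : ℝ × EuclideanSpace ℝ (Fin 2) => ‖fderiv ℝ u p.2‖ :=
        (hfc.comp continuous_snd).norm
      exact ((measurableSet_lt measurable_const measurable_fst).inter
        (measurableSet_lt measurable_fst measurable_const)).inter
        ((measurableSet_le hu2.measurable measurable_fst).inter
        (measurableSet_lt measurable_fst
        (hu2.add (continuous_const.mul (hf2.add continuous_const))).measurable))
    have hWl : ENNReal.ofReal (2 * √π * ε * √β) * ENNReal.ofReal (b - (a + η)) ≤
        (volume.prod volume) W := by
      rw [Measure.prod_apply hWm, ← Real.volume_Ioo, ← setLIntegral_const]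
      refine le_trans (setLIntegral_mono' measurableSet_Ioo (g := fun t =>
        volume (Prod.mk t ⁻¹' W)) fun t ht => (hD t ht).trans (measure_mono fun x hx => ?_))
        (setLIntegral_le_lintegral _ _)
      exact ⟨ht, hx⟩
    have hWu : (volume.prod volume) W ≤
        ∫⁻ x in S, ENNReal.ofReal (ε * (‖fderiv ℝ u x‖ + η)) := by
      rw [Measure.prod_apply_symm hWm, ← lintegral_indicator hSm]
      refine lintegral_mono fun x => ?_
      by_cases hx : x ∈ S
      · rw [Set.indicator_of_mem hx]
        have : ε * (‖fderiv ℝ u x‖ + η) = |u x| + ε * (‖fderiv ℝ u x‖ + η) - |u x| := by ring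
        rw [this, ← Real.volume_Ico]
        exact measure_mono fun t ht => ht.2
      · rw [Set.indicator_of_notMem hx, nonpos_iff_eq_zero]
        convert measure_empty (μ := (volume : Measure ℝ))
        ext t
        simp only [Set.mem_preimage, hW, Set.mem_ofPred_eq, Set.mem_empty_iff_false, iff_false]
        rintro ⟨⟨h1, h2⟩, h3, h4⟩
        have := hεη x
        exact hx ⟨by linarith, by linarith⟩
    have hgi : IntegrableOn (fun x => ε * (‖fderiv ℝ u x‖ + η)) S :=
      (hfi.add (integrableOn_const hSt)).const_mul ε
    have h := hWl.trans hWu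
    rw [← ofReal_integral_eq_lintegral_ofReal hgi
      (Filter.Eventually.of_forall fun x => by positivity),
      ← ENNReal.ofReal_mul (by positivity), ENNReal.ofReal_le_ofReal_iff
      (integral_nonneg fun x => by positivity), integral_const_mul,
      integral_add hfi (integrableOn_const hSt), setIntegral_const] at h
    refine le_of_mul_le_mul_left ?_ hε
    simp only [smul_eq_mul, Measure.real] at h
    nlinarith
  refine le_of_forall_pos_le_add fun γ hγ => ?_
  set K := (volume S).toReal + 2 * √π * √β
  have hK : 0 ≤ K := by positivity
  have hη : 0 < min (γ / (K + 1)) ((b - a) / 2) := lt_min (by positivity) (by linarith)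
  have h := core _ hη ((min_le_right _ _).trans_lt (by linarith))
  have h2 : min (γ / (K + 1)) ((b - a) / 2) * (K + 1) ≤ γ := by
    rw [← le_div_iff₀ (by positivity)]
    exact min_le_left _ _
  nlinarith

/-- The Dirichlet energy of `u` on the set where `|u|` lies strictly between `a` and `b`. -/
noncomputable def bandEnergy (u : EuclideanSpace ℝ (Fin 2) → ℝ) (a b : ℝ) : ℝ :=
  ∫ x in {x | a < |u x| ∧ |u x| < b}, ‖fderiv ℝ u x‖ ^ 2

lemma bandEnergy_nonneg (u : EuclideanSpace ℝ (Fin 2) → ℝ) (a b : ℝ) : 0 ≤ bandEnergy u a b :=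
  integral_nonneg fun _ => by positivity

lemma integrable_norm_fderiv_sq (hu : ContDiff ℝ 1 u) (hc : HasCompactSupport u) :
    Integrable fun x => ‖fderiv ℝ u x‖ ^ 2 := by
  have hs : HasCompactSupport fun x => ‖fderiv ℝ u x‖ ^ 2 :=
    (hc.fderiv ℝ).norm.comp_left (g := fun z : ℝ => z ^ 2) (by norm_num)
  have hf : Continuous fun x => ‖fderiv ℝ u x‖ ^ 2 :=
    (hu.continuous_fderiv one_ne_zero).norm.pow 2
  exact hf.integrable_of_hasCompactSupport hs

lemma bandEnergy_le_integral (hu : ContDiff ℝ 1 u) (hc : HasCompactSupport u) (a b : ℝ) :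
    bandEnergy u a b ≤ ∫ x, ‖fderiv ℝ u x‖ ^ 2 :=
  setIntegral_le_integral (integrable_norm_fderiv_sq hu hc)
    (Filter.Eventually.of_forall fun _ => by positivity)

lemma bandEnergy_add_le (hu : ContDiff ℝ 1 u) (hc : HasCompactSupport u) {a c b : ℝ}
    (hac : a ≤ c) (hcb : c ≤ b) : bandEnergy u a c + bandEnergy u c b ≤ bandEnergy u a b := by
  have hi := integrable_norm_fderiv_sq hu hc
  have hd : Disjoint {x | a < |u x| ∧ |u x| < c} {x | c < |u x| ∧ |u x| < b} :=
    Set.disjoint_left.2 fun x h1 h2 => lt_asymm h1.2 h2.1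
  rw [bandEnergy, bandEnergy, bandEnergy, ← setIntegral_union hd
    (measurableSet_lt_abs_and_lt hu.continuous c b) hi.integrableOn hi.integrableOn]
  refine setIntegral_mono_set hi.integrableOn
    (Filter.Eventually.of_forall fun _ => by positivity) (Filter.Eventually.of_forall ?_)
  rintro x (⟨h1, h2⟩ | ⟨h1, h2⟩)
  · exact ⟨h1, h2.trans_le hcb⟩
  · exact ⟨hac.trans_lt h1, h2⟩

lemma four_pi_mul_sq_mul_le_bandEnergy_mul (hu : ContDiff ℝ 1 u) (hc : HasCompactSupport u)
    {a b : ℝ} (ha : 0 ≤ a) (hab : a < b) :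
    4 * π * (b - a) ^ 2 * (volume {x | b ≤ |u x|}).toReal ≤
      bandEnergy u a b * (volume {x | a < |u x| ∧ |u x| < b}).toReal := by
  have h := two_mul_sqrt_pi_mul_le_setIntegral hu hc ha hab
  set β := (volume {x | b ≤ |u x|}).toReal
  rw [bandEnergy]
  set S := {x | a < |u x| ∧ |u x| < b} with hS
  have hSt : volume S ≠ ∞ := ne_top_of_le_ne_top
    (measure_lt_abs_lt_top hc ha).ne (measure_mono fun x hx => hx.1)
  set f := fun x => ‖fderiv ℝ u x‖ with hf
  have hfi : IntegrableOn f S :=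
    ((hu.continuous_fderiv one_ne_zero).norm.integrable_of_hasCompactSupport
      (hc.fderiv ℝ).norm).integrableOn
  have hf2 : IntegrableOn (fun x => f x ^ 2) S := (integrable_norm_fderiv_sq hu hc).integrableOn
  have hq : ∀ l : ℝ, 0 ≤ (volume S).toReal * (l * l) + (-2 * ∫ x in S, f x) * l +
      ∫ x in S, f x ^ 2 := by
    intro l
    have h0 : 0 ≤ ∫ x in S, (f x - l) ^ 2 := integral_nonneg fun _ => by positivity
    have h1 : ∫ x in S, (f x - l) ^ 2 = (∫ x in S, f x ^ 2) - 2 * l * (∫ x in S, f x) +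
        l ^ 2 * (volume S).toReal := by
      have : ∀ x, (f x - l) ^ 2 = (f x ^ 2 - 2 * l * f x) + l ^ 2 := fun x => by ring
      have hd : IntegrableOn (fun x => f x ^ 2 - 2 * l * f x) S := hf2.sub (hfi.const_mul _)
      simp_rw [this]
      rw [integral_add hd (integrableOn_const hSt), integral_sub hf2 (hfi.const_mul _),
        integral_const_mul, setIntegral_const, smul_eq_mul, Measure.real, mul_comm (volume S).toReal]
    linarith
  have hdisc := discrim_le_zero hq
  rw [discrim] at hdisc
  have hab' : 0 < b - a := sub_pos.2 hab
  have hsq : (2 * √π * (b - a) * √β) ^ 2 = 4 * π * (b - a) ^ 2 * β := by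
    rw [mul_pow, mul_pow, mul_pow, Real.sq_sqrt pi_pos.le, Real.sq_sqrt ENNReal.toReal_nonneg]
    ring
  rw [← hsq]
  have := pow_le_pow_left₀ (by positivity) h 2
  nlinarith

/-- Every measure between those of two superlevel sets is attained, up to a jump of the
distribution function, at an intermediate level. -/
lemma exists_measure_lt_abs_le_le (hu : Continuous u) (hc : HasCompactSupport u) {a b : ℝ}
    (ha : 0 ≤ a) (hab : a ≤ b) {s : ℝ≥0∞} (hsb : volume {x | b < |u x|} ≤ s)
    (hsa : s ≤ volume {x | a < |u x|}) :
    ∃ t, a ≤ t ∧ t ≤ b ∧ volume {x | t < |u x|} ≤ s ∧ s ≤ volume {x | t ≤ |u x|} := by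
  set T := {t | a ≤ t ∧ t ≤ b ∧ volume {x | t < |u x|} ≤ s}
  have hbT : b ∈ T := ⟨hab, le_rfl, hsb⟩
  have hbdd : BddBelow T := ⟨a, fun t ht => ht.1⟩
  have hat : a ≤ sInf T := le_csInf ⟨b, hbT⟩ fun t ht => ht.1
  refine ⟨sInf T, hat, csInf_le hbdd hbT, ?_, ?_⟩
  · have hU : {x | sInf T < |u x|} = ⋃ n : ℕ, {x | sInf T + 1 / ((n : ℝ) + 1) < |u x|} := by
      ext x
      simp only [Set.mem_ofPred_eq, Set.mem_iUnion]
      constructor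
      · intro h
        obtain ⟨n, hn⟩ := exists_nat_one_div_lt (sub_pos.2 h)
        exact ⟨n, by linarith⟩
      · rintro ⟨n, hn⟩
        have : 0 < 1 / ((n : ℝ) + 1) := by positivity
        linarith
    rw [hU]
    refine le_of_tendsto' (tendsto_measure_iUnion_atTop (μ := volume) ?_) fun n => ?_
    · intro i j hij x hx
      simp only [Set.mem_ofPred_eq] at hx ⊢
      refine lt_of_le_of_lt ?_ hx
      gcongr
    · have hlt : sInf T < sInf T + 1 / ((n : ℝ) + 1) := by
        have : 0 < 1 / ((n : ℝ) + 1) := by positivity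
        linarith
      obtain ⟨t, ht, htlt⟩ := exists_lt_of_csInf_lt ⟨b, hbT⟩ hlt
      exact (measure_mono fun x hx => htlt.trans hx).trans ht.2.2
  · rcases hat.eq_or_lt with h | h
    · rw [← h]
      exact hsa.trans (measure_mono fun x hx => show a ≤ |u x| from le_of_lt hx)
    · have hI : {x | sInf T ≤ |u x|} =
          ⋂ n : ℕ, {x | max a (sInf T - 1 / ((n : ℝ) + 1)) < |u x|} := by
        ext x
        simp only [Set.mem_ofPred_eq, Set.mem_iInter]
        constructor
        · intro hx n
          have : 0 < 1 / ((n : ℝ) + 1) := by positivity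
          exact max_lt (by linarith) (by linarith)
        · intro hx
          by_contra! hlt
          obtain ⟨n, hn⟩ := exists_nat_one_div_lt (sub_pos.2 hlt)
          have := (le_max_right a _).trans_lt (hx n)
          linarith
      rw [hI]
      refine ge_of_tendsto' (tendsto_measure_iInter_atTop (μ := volume) (fun n =>
        (measurableSet_lt measurable_const hu.abs.measurable).nullMeasurableSet) ?_
        ⟨0, (measure_lt_abs_lt_top hc (ha.trans (le_max_left _ _))).ne⟩) fun n => ?_
      · intro i j hij x hx
        simp only [Set.mem_ofPred_eq] at hx ⊢
        refine lt_of_le_of_lt ?_ hx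
        gcongr
      · have hlt : max a (sInf T - 1 / ((n : ℝ) + 1)) < sInf T := by
          have : 0 < 1 / ((n : ℝ) + 1) := by positivity
          exact max_lt h (by linarith)
        by_contra! hn
        have := csInf_le hbdd (show max a (sInf T - 1 / ((n : ℝ) + 1)) ∈ T from
          ⟨le_max_left _ _, hlt.le.trans (csInf_le hbdd hbT), hn.le⟩)
        linarith

lemma four_pi_mul_sq_mul_le_of_measure_le (hu : ContDiff ℝ 1 u) (hc : HasCompactSupport u)
    {a b s r : ℝ} (ha : 0 ≤ a) (hab : a ≤ b) (hr : 0 ≤ r) (hrs : r ≤ s)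
    (hsa : volume {x | a < |u x|} ≤ ENNReal.ofReal s)
    (hrb : ENNReal.ofReal r ≤ volume {x | b ≤ |u x|}) :
    4 * π * (b - a) ^ 2 * r ≤ bandEnergy u a b * (s - r) := by
  rcases hab.eq_or_lt with rfl | hlt
  · have := mul_nonneg (bandEnergy_nonneg u a a) (sub_nonneg.2 hrs)
    simpa using this
  have hbt : volume {x | b ≤ |u x|} ≠ ∞ := ne_top_of_le_ne_top
    (measure_lt_abs_lt_top hc ha).ne (measure_mono fun x hx => hlt.trans_le hx)
  have hSt : volume {x | a < |u x| ∧ |u x| < b} ≠ ∞ := ne_top_of_le_ne_top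
    (measure_lt_abs_lt_top hc ha).ne (measure_mono fun x hx => hx.1)
  have hsum : volume {x | a < |u x| ∧ |u x| < b} + volume {x | b ≤ |u x|} ≤ ENNReal.ofReal s := by
    rw [← measure_union (Set.disjoint_left.2 fun x h1 h2 => h1.2.not_ge h2)
      (measurableSet_le measurable_const hu.continuous.abs.measurable)]
    refine (measure_mono ?_).trans hsa
    rintro x (h | h)
    · exact h.1
    · exact hlt.trans_le h
  have hsum' := ENNReal.toReal_mono ENNReal.ofReal_ne_top hsum
  rw [ENNReal.toReal_add hSt hbt, ENNReal.toReal_ofReal (hr.trans hrs)] at hsum'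
  have hrb' : r ≤ (volume {x | b ≤ |u x|}).toReal := (ENNReal.ofReal_le_iff_le_toReal hbt).1 hrb
  calc 4 * π * (b - a) ^ 2 * r ≤ 4 * π * (b - a) ^ 2 * (volume {x | b ≤ |u x|}).toReal := by
        gcongr
    _ ≤ bandEnergy u a b * (volume {x | a < |u x| ∧ |u x| < b}).toReal :=
        four_pi_mul_sq_mul_le_bandEnergy_mul hu hc ha hlt
    _ ≤ bandEnergy u a b * (s - r) :=
        mul_le_mul_of_nonneg_left (by linarith) (bandEnergy_nonneg u a b)

/-- Sharp capacity estimate: the energy between two levels dominates the conformal modulus of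
the annulus with the same measures. -/
lemma four_pi_mul_sq_le_bandEnergy_mul_log (hu : ContDiff ℝ 1 u) (hc : HasCompactSupport u)
    {a b : ℝ} (ha : 0 ≤ a) (hab : a < b) (hb : volume {x | b < |u x|} ≠ 0) :
    4 * π * (b - a) ^ 2 ≤ bandEnergy u a b *
      Real.log ((volume {x | a < |u x|}).toReal / (volume {x | b < |u x|}).toReal) := by
  have hat := (measure_lt_abs_lt_top hc ha).ne
  have hbt := (measure_lt_abs_lt_top hc (ha.trans hab.le)).ne
  set A := (volume {x | a < |u x|}).toReal with hA
  set B := (volume {x | b < |u x|}).toReal with hB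
  have hB0 : 0 < B := ENNReal.toReal_pos hb hbt
  have hBA : B ≤ A := ENNReal.toReal_mono hat (measure_mono fun x hx => hab.trans hx)
  have hA0 : 0 < A := hB0.trans_le hBA
  have hAe : volume {x | a < |u x|} = ENNReal.ofReal A := (ENNReal.ofReal_toReal hat).symm
  have hBe : volume {x | b < |u x|} = ENNReal.ofReal B := (ENNReal.ofReal_toReal hbt).symm
  have hle : ∀ t, volume {x | t < |u x|} ≤ volume {x | t ≤ |u x|} := fun t =>
    measure_mono fun x hx => show t ≤ |u x| from le_of_lt hx
  set L := Real.log (A / B) with hLdef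
  have hL0 : 0 ≤ L := Real.log_nonneg (by rwa [one_le_div hB0])
  rcases hL0.eq_or_lt with hL | hL
  · have hABe : A = B := by
      have := Real.eq_one_of_pos_of_log_eq_zero (by positivity) hL.symm
      field_simp at this
      exact this
    have h := four_pi_mul_sq_mul_le_of_measure_le hu hc ha hab.le hB0.le hBA hAe.le
      (hBe ▸ hle b)
    rw [hABe, sub_self, mul_zero] at h
    rw [← hL, mul_zero]
    exact nonpos_of_mul_nonpos_left h hB0
  have core : ∀ N : ℕ, 0 < N → 4 * π * (b - a) ^ 2 ≤
      bandEnergy u a b * (N * (Real.exp (L / N) - 1)) := by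
    intro N hN
    have hN' : (0 : ℝ) < N := by exact_mod_cast hN
    set s : ℕ → ℝ := fun i => A * Real.exp (-(L * i / N)) with hs
    have hs0 : ∀ i, 0 < s i := fun i => by positivity
    have hs_zero : s 0 = A := by simp [hs]
    have hs_N : s N = B := by
      simp only [hs]
      rw [mul_div_assoc, div_self hN'.ne', mul_one, Real.exp_neg, hLdef,
        Real.exp_log (by positivity)]
      field_simp
    have hs_anti : StrictAnti s := by
      intro i j hij
      have : (i : ℝ) < j := by exact_mod_cast hij
      simp only [hs]
      gcongr
    have hs_succ : ∀ i, s i = s (i + 1) * Real.exp (L / N) := by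
      intro i
      simp only [hs]
      rw [mul_assoc, ← Real.exp_add]
      congr 2
      push_cast
      field_simp
      ring
    have hex : ∀ i, ∃ t, i ≤ N → a ≤ t ∧ t ≤ b ∧ volume {x | t < |u x|} ≤ ENNReal.ofReal (s i) ∧
        ENNReal.ofReal (s i) ≤ volume {x | t ≤ |u x|} ∧ (i = 0 → t = a) ∧ (i = N → t = b) := by
      intro i
      rcases Nat.eq_zero_or_pos i with rfl | hi
      · refine ⟨a, fun _ => ⟨le_rfl, hab.le, ?_, ?_, fun _ => rfl, fun h => by omega⟩⟩
        · rw [hs_zero, hAe]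
        · rw [hs_zero, ← hAe]; exact hle a
      by_cases hiN : i = N
      · refine ⟨b, fun _ => ⟨hab.le, le_rfl, ?_, ?_, fun h => by omega, fun _ => rfl⟩⟩
        · rw [hiN, hs_N, hBe]
        · rw [hiN, hs_N, ← hBe]; exact hle b
      by_cases hle' : i ≤ N
      · obtain ⟨t, h1, h2, h3, h4⟩ := exists_measure_lt_abs_le_le hu.continuous hc ha hab.le
          (s := ENNReal.ofReal (s i))
          (by rw [hBe, ← hs_N]; exact ENNReal.ofReal_le_ofReal (hs_anti.antitone hle'))
          (by rw [hAe, ← hs_zero]; exact ENNReal.ofReal_le_ofReal (hs_anti.antitone hi.le))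
        exact ⟨t, fun _ => ⟨h1, h2, h3, h4, fun h => by omega, fun h => absurd h hiN⟩⟩
      · exact ⟨0, fun h => absurd h hle'⟩
    choose t ht using hex
    have ht_zero : t 0 = a := (ht 0 (Nat.zero_le _)).2.2.2.2.1 rfl
    have ht_N : t N = b := (ht N le_rfl).2.2.2.2.2 rfl
    have hmono : ∀ i < N, t i ≤ t (i + 1) := by
      intro i hi
      by_contra! hlt
      have h1 := (ht i hi.le).2.2.2.1
      have h2 := (ht (i + 1) hi).2.2.1
      have h3 : volume {x | t i ≤ |u x|} ≤ volume {x | t (i + 1) < |u x|} :=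
        measure_mono fun x hx => hlt.trans_le hx
      have h4 := h1.trans (h3.trans h2)
      rw [ENNReal.ofReal_le_ofReal_iff (hs0 _).le] at h4
      exact absurd (hs_anti (Nat.lt_succ_self i)) h4.not_gt
    have hstep : ∀ i < N, 4 * π * (t (i + 1) - t i) ^ 2 ≤
        bandEnergy u (t i) (t (i + 1)) * (Real.exp (L / N) - 1) := by
      intro i hi
      have h := four_pi_mul_sq_mul_le_of_measure_le hu hc (ha.trans (ht i hi.le).1) (hmono i hi)
        (hs0 (i + 1)).le (hs_anti (Nat.lt_succ_self i)).le (ht i hi.le).2.2.1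
        (ht (i + 1) hi).2.2.2.1
      rw [hs_succ i] at h
      refine le_of_mul_le_mul_right ?_ (hs0 (i + 1))
      linarith
    have henergy : ∀ n ≤ N, ∑ i ∈ Finset.range n, bandEnergy u (t i) (t (i + 1)) ≤
        bandEnergy u a (t n) := by
      intro n
      induction n with
      | zero => intro _; simpa using bandEnergy_nonneg u a (t 0)
      | succ n ih =>
        intro hn
        rw [Finset.sum_range_succ]
        have h1 := ih (by omega)
        have h2 := bandEnergy_add_le hu hc (ht n (by omega)).1 (hmono n (by omega))
        linarith
    have htel : b - a = ∑ i ∈ Finset.range N, (t (i + 1) - t i) := by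
      rw [Finset.sum_range_sub, ht_N, ht_zero]
    have hexp : 0 ≤ Real.exp (L / N) - 1 := by
      have := Real.one_le_exp (show 0 ≤ L / N by positivity)
      linarith
    have hE := henergy N le_rfl
    rw [ht_N] at hE
    calc 4 * π * (b - a) ^ 2
        ≤ 4 * π * (N * ∑ i ∈ Finset.range N, (t (i + 1) - t i) ^ 2) := by
          rw [htel]
          have := sq_sum_le_card_mul_sum_sq (s := Finset.range N) (f := fun i => t (i + 1) - t i)
          rw [Finset.card_range] at this
          gcongr
      _ = N * ∑ i ∈ Finset.range N, 4 * π * (t (i + 1) - t i) ^ 2 := by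
          rw [← Finset.mul_sum]; ring
      _ ≤ N * ∑ i ∈ Finset.range N,
            bandEnergy u (t i) (t (i + 1)) * (Real.exp (L / N) - 1) := by
          refine mul_le_mul_of_nonneg_left (Finset.sum_le_sum fun i hi => ?_) hN'.le
          exact hstep i (Finset.mem_range.1 hi)
      _ = N * ((∑ i ∈ Finset.range N, bandEnergy u (t i) (t (i + 1))) *
            (Real.exp (L / N) - 1)) := by
          rw [Finset.sum_mul]
      _ ≤ N * (bandEnergy u a b * (Real.exp (L / N) - 1)) := by gcongr
      _ = bandEnergy u a b * (N * (Real.exp (L / N) - 1)) := by ring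
  have hlim : Filter.Tendsto (fun N : ℕ => bandEnergy u a b * (L + L ^ 2 / (N : ℝ)))
      Filter.atTop (nhds (bandEnergy u a b * (L + 0))) :=
    ((tendsto_const_div_atTop_nhds_zero_nat _).const_add L).const_mul _
  rw [add_zero] at hlim
  refine ge_of_tendsto hlim ?_
  filter_upwards [Filter.eventually_gt_atTop 0, Filter.eventually_ge_atTop ⌈L⌉₊] with N hN hNL
  have hN' : (0 : ℝ) < N := by exact_mod_cast hN
  refine (core N hN).trans (mul_le_mul_of_nonneg_left ?_ (bandEnergy_nonneg u a b))
  have h1 : |L / N| ≤ 1 := by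
    rw [abs_of_nonneg (by positivity), div_le_one hN']
    exact Nat.ceil_le.1 hNL
  have h2 := (abs_le.1 (Real.abs_exp_sub_one_sub_id_le h1)).2
  calc N * (Real.exp (L / N) - 1) ≤ N * (L / N + (L / N) ^ 2) := by gcongr; linarith
    _ = L + L ^ 2 / N := by field_simp

end LevelSets

/-- The increment bound behind Moser's one-dimensional inequality: two points where `T - ρ` is
at most `l`, away from the origin, are within `10 * l` of each other. -/
lemma sub_le_of_energy_le {ρ₁ ρ₂ T₁ T₂ E₁ E₂ l : ℝ} (hl : 0 < l) (h8 : 8 * l ≤ ρ₁)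
    (h12 : ρ₁ < ρ₂) (hE₂ : 0 ≤ E₂) (hE : E₁ + E₂ ≤ 1)
    (h₁ : ρ₁ ≤ E₁ * T₁) (h₂ : (√ρ₂ - √ρ₁) ^ 2 ≤ E₂ * (T₂ - T₁)) (hT : ρ₁ ≤ T₁)
    (hl₁ : T₁ ≤ ρ₁ + l) (hl₂ : T₂ ≤ ρ₂ + l) : ρ₂ - ρ₁ ≤ 10 * l := by
  have hρ₁ : 0 < ρ₁ := by linarith
  have hρ₂ : 0 < ρ₂ := by linarith
  have hE₂ρ : E₂ * ρ₁ ≤ l := by nlinarith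
  set d := ρ₂ - ρ₁ with hd
  have hd0 : 0 < d := sub_pos.2 h12
  have hTd : T₂ - T₁ ≤ d + l := by linarith
  have hsq₁ := Real.sq_sqrt hρ₁.le
  have hsq₂ := Real.sq_sqrt hρ₂.le
  have hdiff : d = (√ρ₂ - √ρ₁) * (√ρ₂ + √ρ₁) := by nlinarith
  have hsum : (√ρ₂ + √ρ₁) ^ 2 ≤ 4 * (ρ₁ + d) := by
    nlinarith [sq_nonneg (√ρ₂ - √ρ₁)]
  have h3 : (√ρ₂ - √ρ₁) ^ 2 ≤ E₂ * (d + l) := h₂.trans (by gcongr)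
  have h4 : d ^ 2 ≤ E₂ * (d + l) * (4 * (ρ₁ + d)) := by
    rw [hdiff, mul_pow, ← hdiff]
    gcongr
  have h5 : d ^ 2 * ρ₁ ≤ l * (d + l) * (4 * (ρ₁ + d)) := by
    calc d ^ 2 * ρ₁ ≤ E₂ * (d + l) * (4 * (ρ₁ + d)) * ρ₁ := by gcongr
      _ = (E₂ * ρ₁) * (d + l) * (4 * (ρ₁ + d)) := by ring
      _ ≤ l * (d + l) * (4 * (ρ₁ + d)) := by gcongr
  by_contra! h
  have h6 : l * d * (d + l) * 4 ≤ ρ₁ * (d * (d + l)) / 2 := by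
    have : 0 ≤ d * (d + l) := by positivity
    nlinarith
  have h7 : d ^ 2 * ρ₁ ≤ (4 * l * (d + l) + d * (d + l) / 2) * ρ₁ := by linarith
  have h8 := le_of_mul_le_mul_right h7 hρ₁
  nlinarith

section Moser

variable {u : EuclideanSpace ℝ (Fin 2) → ℝ}

lemma setOf_lt_four_pi_mul_sq (u : EuclideanSpace ℝ (Fin 2) → ℝ) {ρ : ℝ} (hρ : 0 ≤ ρ) :
    {x | ρ < 4 * π * u x ^ 2} = {x | √(ρ / (4 * π)) < |u x|} := by
  ext x
  simp only [Set.mem_ofPred_eq]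
  rw [Real.sqrt_lt (by positivity) (abs_nonneg _), sq_abs, div_lt_iff₀' (by positivity)]

lemma four_pi_mul_sqrt_sub_sqrt_sq (ρ₁ ρ₂ : ℝ) :
    4 * π * (√(ρ₂ / (4 * π)) - √(ρ₁ / (4 * π))) ^ 2 = (√ρ₂ - √ρ₁) ^ 2 := by
  rw [Real.sqrt_div' _ (by positivity), Real.sqrt_div' _ (by positivity), ← sub_div, div_pow,
    Real.sq_sqrt (by positivity)]
  field_simp

/-- Moser's lemma: the set of heights at which the distribution function of `4 * π * u ^ 2` is
within a factor `exp (-l)` of the extremal profile `m * exp (-ρ)` has length at most `18 * l`. -/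
lemma volume_setOf_log_lt_le (hu : ContDiff ℝ 1 u) (hc : HasCompactSupport u)
    (hu1 : ∫ x, ‖fderiv ℝ u x‖ ^ 2 ≤ 1) {m : ℝ} (hm0 : 0 < m)
    (hm : volume {x | 0 < |u x|} ≤ ENNReal.ofReal m) {l : ℝ} (hl : 0 < l) :
    volume {ρ : ℝ | 0 < ρ ∧ volume {x | ρ < 4 * π * u x ^ 2} ≠ 0 ∧
      Real.log (m / (volume {x | ρ < 4 * π * u x ^ 2}).toReal) < ρ + l} ≤
      ENNReal.ofReal (18 * l) := by
  set X := {ρ : ℝ | 0 < ρ ∧ volume {x | ρ < 4 * π * u x ^ 2} ≠ 0 ∧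
      Real.log (m / (volume {x | ρ < 4 * π * u x ^ 2}).toReal) < ρ + l}
  set T : ℝ → ℝ := fun ρ => Real.log (m / (volume {x | ρ < 4 * π * u x ^ 2}).toReal) with hT
  set r : ℝ → ℝ := fun ρ => √(ρ / (4 * π)) with hr
  have hset : ∀ ρ, 0 ≤ ρ → {x | ρ < 4 * π * u x ^ 2} = {x | r ρ < |u x|} := fun ρ hρ =>
    setOf_lt_four_pi_mul_sq u hρ
  have hr0 : r 0 = 0 := by simp [hr]
  have hrlt : ∀ s t, 0 ≤ s → s < t → r s < r t := fun s t hs hst =>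
    Real.sqrt_lt_sqrt (by positivity) (by gcongr)
  have hpos : ∀ ρ ∈ X, 0 < (volume {x | ρ < 4 * π * u x ^ 2}).toReal := by
    intro ρ hρ
    refine ENNReal.toReal_pos hρ.2.1 ?_
    rw [hset ρ hρ.1.le]
    exact (measure_lt_abs_lt_top hc (Real.sqrt_nonneg _)).ne
  have hone : ∀ ρ ∈ X, ρ ≤ bandEnergy u 0 (r ρ) * T ρ := by
    intro ρ hρ
    have hrρ := hrlt 0 ρ le_rfl hρ.1
    rw [hr0] at hrρ
    have h := four_pi_mul_sq_le_bandEnergy_mul_log hu hc le_rfl hrρ (by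
      rw [← hset ρ hρ.1.le]; exact hρ.2.1)
    have h0 := four_pi_mul_sqrt_sub_sqrt_sq 0 ρ
    simp only [zero_div, Real.sqrt_zero, sub_zero, Real.sq_sqrt hρ.1.le] at h0
    rw [sub_zero, h0, ← hset ρ hρ.1.le] at h
    refine h.trans (mul_le_mul_of_nonneg_left ?_ (bandEnergy_nonneg _ _ _))
    have hp := hpos ρ hρ
    have hle : (volume {x | ρ < 4 * π * u x ^ 2}).toReal ≤ (volume {x | 0 < |u x|}).toReal := by
      refine ENNReal.toReal_mono (measure_lt_abs_lt_top hc le_rfl).ne ?_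
      rw [hset ρ hρ.1.le]
      exact measure_mono fun x hx => hrρ.trans hx
    refine Real.log_le_log (div_pos (hp.trans_le hle) hp) ?_
    gcongr
    exact ENNReal.toReal_le_of_le_ofReal hm0.le hm
  have htwo : ∀ ρ₁ ∈ X, ∀ ρ₂ ∈ X, ρ₁ < ρ₂ →
      (√ρ₂ - √ρ₁) ^ 2 ≤ bandEnergy u (r ρ₁) (r ρ₂) * (T ρ₂ - T ρ₁) := by
    intro ρ₁ h1 ρ₂ h2 h12
    have h := four_pi_mul_sq_le_bandEnergy_mul_log hu hc (Real.sqrt_nonneg _)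
      (hrlt ρ₁ ρ₂ h1.1.le h12) (by rw [← hset ρ₂ h2.1.le]; exact h2.2.1)
    rw [four_pi_mul_sqrt_sub_sqrt_sq] at h
    change _ ≤ _ * Real.log ((volume {x | r ρ₁ < |u x|}).toReal / _) at h
    rw [← hset ρ₂ h2.1.le, ← hset ρ₁ h1.1.le] at h
    have hp1 := hpos ρ₁ h1
    have hp2 := hpos ρ₂ h2
    rw [Real.log_div hp1.ne' hp2.ne'] at h
    simp only [hT]
    rw [Real.log_div hm0.ne' hp2.ne', Real.log_div hm0.ne' hp1.ne']
    linarith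
  have hgap : ∀ ρ₁ ∈ X, ∀ ρ₂ ∈ X, 8 * l ≤ ρ₁ → ρ₁ < ρ₂ → ρ₂ - ρ₁ ≤ 10 * l := by
    intro ρ₁ h1 ρ₂ h2 h8 h12
    have hE : bandEnergy u 0 (r ρ₁) + bandEnergy u (r ρ₁) (r ρ₂) ≤ 1 :=
      (bandEnergy_add_le hu hc (Real.sqrt_nonneg _) (hrlt ρ₁ ρ₂ h1.1.le h12).le).trans
        ((bandEnergy_le_integral hu hc _ _).trans hu1)
    have hone1 := hone ρ₁ h1
    have hE₁0 := bandEnergy_nonneg u 0 (r ρ₁)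
    have hE₂0 := bandEnergy_nonneg u (r ρ₁) (r ρ₂)
    have hT1 : ρ₁ ≤ T ρ₁ := by
      have : 0 < T ρ₁ := by
        by_contra! h
        have := mul_nonpos_of_nonneg_of_nonpos hE₁0 h
        linarith [h1.1]
      nlinarith
    exact sub_le_of_energy_le hl h8 h12 hE₂0 hE hone1 (htwo ρ₁ h1 ρ₂ h2 h12) hT1
      h1.2.2.le h2.2.2.le
  have hsub : X ⊆ Set.Ioo 0 (8 * l) ∪ (X ∩ Set.Ici (8 * l)) := by
    intro ρ hρ
    rcases lt_or_ge ρ (8 * l) with h | h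
    · exact Or.inl ⟨hρ.1, h⟩
    · exact Or.inr ⟨hρ, h⟩
  have hdiam : volume (X ∩ Set.Ici (8 * l)) ≤ ENNReal.ofReal (10 * l) := by
    refine (Real.volume_le_diam _).trans (Metric.ediam_le fun ρ₁ h1 ρ₂ h2 => ?_)
    rw [edist_dist, Real.dist_eq]
    refine ENNReal.ofReal_le_ofReal ?_
    rcases lt_trichotomy ρ₁ ρ₂ with h | h | h
    · rw [abs_sub_comm, abs_of_pos (sub_pos.2 h)]
      exact hgap ρ₁ h1.1 ρ₂ h2.1 h1.2 h
    · rw [h, sub_self, abs_zero]; positivity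
    · rw [abs_of_pos (sub_pos.2 h)]
      exact hgap ρ₂ h2.1 ρ₁ h1.1 h2.2 h
  calc volume X ≤ volume (Set.Ioo 0 (8 * l)) + volume (X ∩ Set.Ici (8 * l)) :=
        (measure_mono hsub).trans (measure_union_le _ _)
    _ ≤ ENNReal.ofReal (8 * l) + ENNReal.ofReal (10 * l) := by
        gcongr
        rw [Real.volume_Ioo, sub_zero]
    _ = ENNReal.ofReal (18 * l) := by
        rw [← ENNReal.ofReal_add (by positivity) (by positivity)]
        congr 1
        ring

lemma lintegral_neg_log_Ioo :
    ∫⁻ s in Set.Ioo (0 : ℝ) 1, ENNReal.ofReal (-Real.log s) = 1 := by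
  have hi : IntegrableOn (fun s => -Real.log s) (Set.Ioo (0 : ℝ) 1) :=
    ((intervalIntegrable_iff_integrableOn_Ioo_of_le zero_le_one).1
      intervalIntegral.intervalIntegrable_log').neg
  rw [← ofReal_integral_eq_lintegral_ofReal hi, ← integral_Ioc_eq_integral_Ioo,
    ← intervalIntegral.integral_of_le zero_le_one, intervalIntegral.integral_neg, integral_log]
  · simp
  · exact (ae_restrict_mem measurableSet_Ioo).mono fun s hs =>
      neg_nonneg.2 (Real.log_nonpos hs.1.le hs.2.le)

/-- The distribution-function form of the Trudinger–Moser inequality. -/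
lemma lintegral_measure_mul_exp_le (hu : ContDiff ℝ 1 u) (hc : HasCompactSupport u)
    (hu1 : ∫ x, ‖fderiv ℝ u x‖ ^ 2 ≤ 1) {m : ℝ} (hm0 : 0 < m)
    (hm : volume {x | 0 < |u x|} ≤ ENNReal.ofReal m) :
    ∫⁻ ρ in Set.Ioi (0 : ℝ), volume {x | ρ < 4 * π * u x ^ 2} * ENNReal.ofReal (Real.exp ρ) ≤
      ENNReal.ofReal (18 * m) := by
  have hfin : ∀ ρ : ℝ, 0 < ρ → volume {x | ρ < 4 * π * u x ^ 2} ≠ ∞ := by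
    intro ρ hρ
    rw [setOf_lt_four_pi_mul_sq u hρ.le]
    exact (measure_lt_abs_lt_top hc (Real.sqrt_nonneg _)).ne
  set M : ℝ → ℝ := fun ρ => (volume {x | ρ < 4 * π * u x ^ 2}).toReal with hM
  set k : ℝ → ℝ := fun ρ => M ρ / m * Real.exp ρ with hk
  have hMm : Measurable M := by
    have : Antitone fun ρ : ℝ => volume {x | ρ < 4 * π * u x ^ 2} := fun s t hst =>
      measure_mono fun x hx => hst.trans_lt hx
    exact this.measurable.ennreal_toReal
  have hkm : Measurable k := by fun_prop
  have hk0 : ∀ ρ, 0 ≤ k ρ := fun ρ => by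
    have : 0 ≤ M ρ := ENNReal.toReal_nonneg
    positivity
  have hlog : ∀ ρ s, 0 < s → s < k ρ → volume {x | ρ < 4 * π * u x ^ 2} ≠ 0 ∧
      Real.log (m / M ρ) < ρ + -Real.log s := by
    intro ρ s hs hsk
    have hM0 : 0 < M ρ := by
      rcases (ENNReal.toReal_nonneg : 0 ≤ M ρ).eq_or_lt with h | h
      · have hM_zero : M ρ = 0 := h.symm
        have hk_zero : k ρ = 0 := by simp [hk, hM_zero]
        exact absurd (hk_zero ▸ hsk) hs.not_gt
      · exact h
    refine ⟨fun h => by simp [hM, h] at hM0, ?_⟩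
    have h := Real.log_lt_log hs hsk
    simp only [hk] at h
    rw [Real.log_mul (by positivity) (by positivity), Real.log_exp,
      Real.log_div hM0.ne' hm0.ne'] at h
    rw [Real.log_div hm0.ne' hM0.ne']
    linarith
  have hlevel : ∀ s ∈ Set.Ioo (0 : ℝ) 1, (volume.restrict (Set.Ioi 0)) {ρ | s < k ρ} ≤
      ENNReal.ofReal 18 * ENNReal.ofReal (-Real.log s) := by
    intro s hs
    rw [Measure.restrict_apply (measurableSet_lt measurable_const hkm),
      ← ENNReal.ofReal_mul (by norm_num)]
    refine (measure_mono fun ρ hρ => ?_).trans (volume_setOf_log_lt_le hu hc hu1 hm0 hm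
      (neg_pos.2 (Real.log_neg hs.1 hs.2)))
    exact ⟨hρ.2, hlog ρ s hs.1 hρ.1⟩
  have hzero : ∀ s : ℝ, 1 ≤ s → (volume.restrict (Set.Ioi 0)) {ρ | s < k ρ} = 0 := by
    intro s hs
    rw [Measure.restrict_apply (measurableSet_lt measurable_const hkm), ← nonpos_iff_eq_zero]
    refine ge_of_tendsto (f := fun l : ℝ => ENNReal.ofReal (18 * l)) (x := nhdsWithin 0 (Set.Ioi 0))
      ?_ ?_
    · have h : Continuous fun l : ℝ => ENNReal.ofReal (18 * l) :=
        ENNReal.continuous_ofReal.comp (by fun_prop)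
      simpa using (h.tendsto 0).mono_left nhdsWithin_le_nhds
    · filter_upwards [self_mem_nhdsWithin] with l hl
      refine (measure_mono fun ρ hρ => ?_).trans (volume_setOf_log_lt_le hu hc hu1 hm0 hm hl)
      have h1 := hlog ρ s (by linarith) hρ.1
      have h2 := Real.log_nonneg hs
      rw [Set.mem_Ioi] at hl
      exact ⟨hρ.2, h1.1, h1.2.trans_le (by linarith)⟩
  have hsub : Set.Ioo (0 : ℝ) 1 ⊆ Set.Ioi 0 := fun x hx => hx.1
  have hkint : ∫⁻ ρ in Set.Ioi (0 : ℝ), ENNReal.ofReal (k ρ) ≤ ENNReal.ofReal 18 := by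
    rw [lintegral_eq_lintegral_meas_lt _ (Filter.Eventually.of_forall hk0) hkm.aemeasurable,
      ← lintegral_inter_add_sdiff _ (Set.Ioi 0) (measurableSet_Ioo (a := (0 : ℝ)) (b := 1)),
      Set.inter_eq_right.2 hsub, setLIntegral_eq_zero (measurableSet_Ioi.diff measurableSet_Ioo),
      add_zero]
    · refine (setLIntegral_mono' measurableSet_Ioo hlevel).trans ?_
      rw [lintegral_const_mul' _ _ ENNReal.ofReal_ne_top, lintegral_neg_log_Ioo, mul_one]
    · rintro s ⟨hs0, hs⟩
      refine hzero s ?_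
      by_contra! h
      exact hs ⟨hs0, h⟩
  calc ∫⁻ ρ in Set.Ioi (0 : ℝ), volume {x | ρ < 4 * π * u x ^ 2} * ENNReal.ofReal (Real.exp ρ)
      = ∫⁻ ρ in Set.Ioi (0 : ℝ), ENNReal.ofReal m * ENNReal.ofReal (k ρ) := by
        refine setLIntegral_congr_fun measurableSet_Ioi fun ρ hρ => ?_
        rw [← ENNReal.ofReal_toReal (hfin ρ hρ), ← ENNReal.ofReal_mul ENNReal.toReal_nonneg,
          ← ENNReal.ofReal_mul hm0.le]
        congr 1
        simp only [hk, hM]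
        field_simp
    _ ≤ ENNReal.ofReal m * ENNReal.ofReal 18 := by
        rw [lintegral_const_mul' _ _ ENNReal.ofReal_ne_top]
        gcongr
    _ = ENNReal.ofReal (18 * m) := by
        rw [← ENNReal.ofReal_mul hm0.le, mul_comm]

end Moser

/-- Trudinger–Moser inequality for bounded domains in ℝ². -/
theorem trudinger_moser_bounded (m : ℝ) (hm : 0 < m) :
    ∃ C > 0, ∀ (Ω : Set (EuclideanSpace ℝ (Fin 2))), IsOpen Ω →
      volume Ω ≤ ENNReal.ofReal m →
      ∀ α : ℝ, 0 < α → α ≤ 4 * Real.pi →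
      ∀ u : EuclideanSpace ℝ (Fin 2) → ℝ, ContDiff ℝ 1 u → HasCompactSupport u →
        tsupport u ⊆ Ω →
        (∫ x, ‖fderiv ℝ u x‖ ^ 2) ≤ 1 →
        (∫ x in Ω, Real.exp (α * (u x) ^ 2)) ≤ C := by
  refine ⟨19 * m, by positivity, fun Ω hΩ hΩm α hα hα4 u hu hc hsupp hu1 => ?_⟩
  have hm' : volume {x | 0 < |u x|} ≤ ENNReal.ofReal m :=
    (measure_mono fun x hx => hsupp (subset_tsupport u (abs_pos.1 hx))).trans hΩm
  have hmeas : Continuous fun x => 4 * π * u x ^ 2 := continuous_const.mul (hu.continuous.pow 2)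
  have hcake := lintegral_comp_eq_lintegral_meas_lt_mul (f := fun x => 4 * π * u x ^ 2)
    (g := Real.exp) volume (Filter.Eventually.of_forall fun x => by positivity)
    hmeas.measurable.aemeasurable (fun t _ => intervalIntegral.intervalIntegrable_exp)
    (Filter.Eventually.of_forall fun t => (Real.exp_pos t).le)
  have hbound := hcake.trans_le (lintegral_measure_mul_exp_le hu hc hu1 hm hm')
  simp only [integral_exp, Real.exp_zero] at hbound
  have hexp : Continuous fun x => Real.exp (α * u x ^ 2) :=
    Real.continuous_exp.comp (continuous_const.mul (hu.continuous.pow 2))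
  rw [integral_eq_lintegral_of_nonneg_ae (Filter.Eventually.of_forall fun x => (Real.exp_pos _).le)
    hexp.aestronglyMeasurable]
  refine ENNReal.toReal_le_of_le_ofReal (by positivity) ?_
  calc ∫⁻ x in Ω, ENNReal.ofReal (Real.exp (α * u x ^ 2))
      ≤ ∫⁻ x in Ω, (1 + ENNReal.ofReal (Real.exp (4 * π * u x ^ 2) - 1)) := by
        refine lintegral_mono fun x => ?_
        have h1 : 1 ≤ Real.exp (4 * π * u x ^ 2) := Real.one_le_exp (by positivity)
        rw [← ENNReal.ofReal_one, ← ENNReal.ofReal_add zero_le_one (by linarith)]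
        refine ENNReal.ofReal_le_ofReal ?_
        rw [add_sub_cancel]
        gcongr
    _ = volume Ω + ∫⁻ x in Ω, ENNReal.ofReal (Real.exp (4 * π * u x ^ 2) - 1) := by
        rw [lintegral_add_left measurable_const, setLIntegral_const, one_mul]
    _ ≤ ENNReal.ofReal m + ENNReal.ofReal (18 * m) :=
        add_le_add hΩm ((setLIntegral_le_lintegral _ _).trans hbound)
    _ = ENNReal.ofReal (19 * m) := by
        rw [← ENNReal.ofReal_add hm.le (by positivity)]
        congr 1
        ring
end

section
/- For every M > 0 and every real number α with 0 < α < 4π there exists a constant C = C(M, α) > 0 such that every continuously differentiable function u : ℝ² → ℝ with compact support satisfying ∫_{ℝ²} ‖∇u(x)‖² dx ≤ 1 and ∫_{ℝ²} u(x)² dx ≤ M² satisfies ∫_{ℝ²} (e^{α u(x)²} − 1) dx ≤ C. -/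
open Real MeasureTheory

/-- The unit vector of the plane at angle `θ`. -/
noncomputable def unitDirection (θ : ℝ) : EuclideanSpace ℝ (Fin 2) := !₂[cos θ, sin θ]

lemma continuous_unitDirection : Continuous unitDirection := by
  unfold unitDirection
  fun_prop

lemma norm_unitDirection (θ : ℝ) : ‖unitDirection θ‖ = 1 := by
  simp [unitDirection, EuclideanSpace.norm_eq]

lemma lintegral_polar {f : EuclideanSpace ℝ (Fin 2) → ENNReal} (hf : Measurable f)
    (x : EuclideanSpace ℝ (Fin 2)) :
    ∫⁻ θ in Set.Ioo (-π) π, ∫⁻ s in Set.Ioi (0 : ℝ),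
      ENNReal.ofReal s * f (x + s • unitDirection θ) = ∫⁻ y, f y := by
  have hrepr (p : ℝ × ℝ) : Complex.orthonormalBasisOneI.repr (Complex.polarCoord.symm p)
      = p.1 • unitDirection p.2 := by
    ext i
    rw [Complex.orthonormalBasisOneI_repr_apply]
    fin_cases i <;> simp [unitDirection, -Complex.ofReal_cos, -Complex.ofReal_sin]
  rw [← lintegral_add_left_eq_self f x,
    ← (LinearIsometryEquiv.measurePreserving
      Complex.orthonormalBasisOneI.repr).lintegral_comp (by fun_prop),
    ← Complex.lintegral_comp_polarCoord_symm]
  simp only [hrepr, smul_eq_mul]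
  rw [polarCoord_target, Measure.volume_eq_prod, ← Measure.prod_restrict, lintegral_prod_symm]
  have := continuous_unitDirection.measurable
  fun_prop

/-- The radial integral of `h` over the annulus, without the polar weight `s`, is controlled by
the `L²` norm of `h`. -/
lemma lintegral_annulus_le {h : EuclideanSpace ℝ (Fin 2) → ℝ} (hh : Continuous h)
    (x : EuclideanSpace ℝ (Fin 2)) {a b c : ℝ} (ha : 0 < a) (hab : a ≤ b)
    (hc : 0 < c) :
    ∫⁻ θ in Set.Ioo (-π) π, ∫⁻ s in Set.Ioc a b, ENNReal.ofReal (h (x + s • unitDirection θ)) ≤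
      ENNReal.ofReal (c / 2) * (∫⁻ y, ENNReal.ofReal (h y ^ 2)) +
        ENNReal.ofReal (π / c * log (b / a)) := by
  have hdir := continuous_unitDirection
  have hpt (θ s : ℝ) (hs : 0 < s) : ENNReal.ofReal (h (x + s • unitDirection θ)) ≤
      ENNReal.ofReal (c / 2) * (ENNReal.ofReal s *
        ENNReal.ofReal (h (x + s • unitDirection θ) ^ 2)) + ENNReal.ofReal (1 / (2 * c) * s⁻¹) := by
    set t := h (x + s • unitDirection θ)
    rw [← ENNReal.ofReal_mul hs.le, ← ENNReal.ofReal_mul (by positivity),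
      ← ENNReal.ofReal_add (by positivity) (by positivity)]
    apply ENNReal.ofReal_le_ofReal
    have : c / 2 * (s * t ^ 2) + 1 / (2 * c) * s⁻¹ - t = (c * s * t - 1) ^ 2 / (2 * c * s) := by
      field_simp
      ring
    have : 0 ≤ (c * s * t - 1) ^ 2 / (2 * c * s) := by positivity
    linarith
  have hlog : ∫⁻ s in Set.Ioc a b, ENNReal.ofReal (1 / (2 * c) * s⁻¹) =
      ENNReal.ofReal (1 / (2 * c) * log (b / a)) := by
    rw [← integral_inv_of_pos ha (ha.trans_le hab), ← intervalIntegral.integral_const_mul,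
      intervalIntegral.integral_of_le hab, ofReal_integral_eq_lintegral_ofReal]
    · rw [← IntegrableOn, ← intervalIntegrable_iff_integrableOn_Ioc_of_le hab]
      apply IntervalIntegrable.const_mul
      apply intervalIntegral.intervalIntegrable_inv
      · intro y hy
        rw [Set.uIcc_of_le hab] at hy
        linarith [hy.1]
      · exact continuousOn_id
    · filter_upwards [ae_restrict_mem measurableSet_Ioc] with s hs
      have := ha.trans hs.1
      positivity
  calc _ ≤ ∫⁻ θ in Set.Ioo (-π) π, ((∫⁻ s in Set.Ioc a b, ENNReal.ofReal (c / 2) *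
          (ENNReal.ofReal s * ENNReal.ofReal (h (x + s • unitDirection θ) ^ 2))) +
          ENNReal.ofReal (1 / (2 * c) * log (b / a))) := by
        gcongr with θ
        rw [← hlog, ← lintegral_add_left (by fun_prop)]
        exact setLIntegral_mono' measurableSet_Ioc fun s hs ↦ hpt θ s (ha.trans hs.1)
    _ = ENNReal.ofReal (c / 2) * (∫⁻ θ in Set.Ioo (-π) π, ∫⁻ s in Set.Ioc a b,
          ENNReal.ofReal s * ENNReal.ofReal (h (x + s • unitDirection θ) ^ 2)) +
          ENNReal.ofReal (π / c * log (b / a)) := by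
        rw [lintegral_add_right _ measurable_const, setLIntegral_const, Real.volume_Ioo]
        congr 1
        · rw [← lintegral_const_mul']
          · congr with θ
            rw [lintegral_const_mul' _ _ ENNReal.ofReal_ne_top]
          · exact ENNReal.ofReal_ne_top
        · rw [← ENNReal.ofReal_mul' (by linarith [pi_pos])]
          congr 1
          field_simp
          ring
    _ ≤ _ := by
        gcongr
        rw [← lintegral_polar (f := fun y ↦ ENNReal.ofReal (h y ^ 2)) (by fun_prop) x]
        gcongr
        exact fun s hs ↦ ha.trans hs.1

/-- Integrating the gradient of `u` along rays starting at `x`. -/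
lemma ofReal_abs_le_lintegral_rays {u : EuclideanSpace ℝ (Fin 2) → ℝ} (hu : ContDiff ℝ 1 u)
    (x : EuclideanSpace ℝ (Fin 2)) :
    ENNReal.ofReal (2 * π * |u x|) ≤
      (∫⁻ θ in Set.Ioo (-π) π, ∫⁻ s in Set.Ioc (1 : ℝ) 2,
        ENNReal.ofReal |u (x + s • unitDirection θ)|) +
      ∫⁻ θ in Set.Ioo (-π) π, ∫⁻ s in Set.Ioc (0 : ℝ) 2,
        ENNReal.ofReal ‖fderiv ℝ u (x + s • unitDirection θ)‖ := by
  have hdir := continuous_unitDirection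
  have huc := hu.continuous
  have hgc := hu.continuous_fderiv one_ne_zero
  have hray (θ r : ℝ) (hr : r ∈ Set.Ioc (1 : ℝ) 2) : ENNReal.ofReal |u x| ≤
      ENNReal.ofReal |u (x + r • unitDirection θ)| + ∫⁻ s in Set.Ioc (0 : ℝ) 2,
        ENNReal.ofReal ‖fderiv ℝ u (x + s • unitDirection θ)‖ := by
    have hr0 : (0 : ℝ) ≤ r := by linarith [hr.1]
    have hderiv (s : ℝ) : HasDerivAt (fun s : ℝ ↦ u (x + s • unitDirection θ))
        (fderiv ℝ u (x + s • unitDirection θ) (unitDirection θ)) s := by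
      have h1 : HasDerivAt (fun s : ℝ ↦ x + s • unitDirection θ) (unitDirection θ) s := by
        simpa using ((hasDerivAt_id s).smul_const (unitDirection θ)).const_add x
      exact ((hu.differentiable one_ne_zero _).hasFDerivAt).comp_hasDerivAt s h1
    have hftc := intervalIntegral.integral_eq_sub_of_hasDerivAt (a := 0) (b := r)
      (fun s _ ↦ hderiv s) (Continuous.intervalIntegrable (by fun_prop) _ _)
    have hbound : |u (x + r • unitDirection θ) - u x| ≤
        ∫ s in (0 : ℝ)..r, ‖fderiv ℝ u (x + s • unitDirection θ)‖ := by
      rw [show u (x + r • unitDirection θ) - u x =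
        ∫ s in (0 : ℝ)..r, fderiv ℝ u (x + s • unitDirection θ) (unitDirection θ) by
          simp [hftc], ← Real.norm_eq_abs]
      apply intervalIntegral.norm_integral_le_of_norm_le hr0
      · refine Filter.Eventually.of_forall fun s _ ↦ ?_
        simpa [norm_unitDirection] using
          (fderiv ℝ u (x + s • unitDirection θ)).le_opNorm (unitDirection θ)
      · exact Continuous.intervalIntegrable (by fun_prop) _ _
    have hradial : ENNReal.ofReal (∫ s in (0 : ℝ)..r, ‖fderiv ℝ u (x + s • unitDirection θ)‖) ≤
        ∫⁻ s in Set.Ioc (0 : ℝ) 2, ENNReal.ofReal ‖fderiv ℝ u (x + s • unitDirection θ)‖ := by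
      rw [intervalIntegral.integral_of_le hr0, ofReal_integral_eq_lintegral_ofReal
        (Continuous.integrableOn_Ioc (by fun_prop))
        (Filter.Eventually.of_forall fun _ ↦ by positivity)]
      exact lintegral_mono_set (Set.Ioc_subset_Ioc_right hr.2)
    refine le_trans (ENNReal.ofReal_le_ofReal (q := |u (x + r • unitDirection θ)| +
      |u (x + r • unitDirection θ) - u x|) ?_) ?_
    · have := abs_sub (u (x + r • unitDirection θ)) (u (x + r • unitDirection θ) - u x)
      simpa using this
    · rw [ENNReal.ofReal_add (by positivity) (by positivity)]
      gcongr
      exact (ENNReal.ofReal_le_ofReal hbound).trans hradial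
  have hcircle (θ : ℝ) : ENNReal.ofReal |u x| ≤ (∫⁻ s in Set.Ioc (1 : ℝ) 2,
        ENNReal.ofReal |u (x + s • unitDirection θ)|) + ∫⁻ s in Set.Ioc (0 : ℝ) 2,
        ENNReal.ofReal ‖fderiv ℝ u (x + s • unitDirection θ)‖ := by
    have hmono := setLIntegral_mono' (μ := volume) measurableSet_Ioc (hray θ)
    rw [lintegral_add_right _ measurable_const] at hmono
    simpa [setLIntegral_const, Real.volume_Ioc, show (2 : ℝ) - 1 = 1 by norm_num] using hmono
  calc ENNReal.ofReal (2 * π * |u x|) = ∫⁻ θ in Set.Ioo (-π) π, ENNReal.ofReal |u x| := by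
        rw [setLIntegral_const, Real.volume_Ioo, ← ENNReal.ofReal_mul (by positivity)]
        congr 1
        ring
    _ ≤ _ := by
        rw [← lintegral_add_left]
        · gcongr with θ
          exact hcircle θ
        · apply Measurable.lintegral_prod_right
          fun_prop

lemma measurable_lintegral_rays {f : EuclideanSpace ℝ (Fin 2) → ENNReal} (hf : Measurable f)
    (S : Set ℝ) : Measurable fun x ↦ ∫⁻ θ in Set.Ioo (-π) π, ∫⁻ s in S,
      f (x + s • unitDirection θ) := by
  have hdir := continuous_unitDirection.measurable
  apply Measurable.lintegral_prod_right
  apply Measurable.lintegral_prod_right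
  fun_prop

lemma lintegral_lintegral_rays {f : EuclideanSpace ℝ (Fin 2) → ENNReal} (hf : Measurable f)
    (S : Set ℝ) : ∫⁻ x, ∫⁻ θ in Set.Ioo (-π) π, ∫⁻ s in S, f (x + s • unitDirection θ) =
      ENNReal.ofReal (2 * π) * (volume S * ∫⁻ y, f y) := by
  have hdir := continuous_unitDirection.measurable
  rw [lintegral_lintegral_swap]
  · have (θ : ℝ) : ∫⁻ x, ∫⁻ s in S, f (x + s • unitDirection θ) = volume S * ∫⁻ y, f y := by
      rw [lintegral_lintegral_swap (Measurable.aemeasurable (by fun_prop))]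
      simp only [lintegral_add_right_eq_self, setLIntegral_const]
      ring
    simp only [this, setLIntegral_const, Real.volume_Ioo]
    rw [mul_comm]
    congr 2
    ring
  · apply Measurable.aemeasurable
    apply Measurable.lintegral_prod_right
    fun_prop

/-- The radial integral of `h` over a disc, in terms of the radial integral of `h ^ 2`. -/
lemma lintegral_disc_le (h : EuclideanSpace ℝ (Fin 2) → ℝ)
    (x : EuclideanSpace ℝ (Fin 2)) {δ : ℝ} (hδ : 0 < δ) :
    ∫⁻ θ in Set.Ioo (-π) π, ∫⁻ s in Set.Ioc 0 δ, ENNReal.ofReal (h (x + s • unitDirection θ)) ≤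
      ENNReal.ofReal (δ / 2) * (∫⁻ θ in Set.Ioo (-π) π, ∫⁻ s in Set.Ioc 0 δ,
        ENNReal.ofReal (h (x + s • unitDirection θ) ^ 2)) + ENNReal.ofReal π := by
  have hpt (t : ℝ) : ENNReal.ofReal t ≤
      ENNReal.ofReal (δ / 2) * ENNReal.ofReal (t ^ 2) + ENNReal.ofReal (1 / (2 * δ)) := by
    rw [← ENNReal.ofReal_mul (by positivity), ← ENNReal.ofReal_add (by positivity) (by positivity)]
    apply ENNReal.ofReal_le_ofReal
    have : δ / 2 * t ^ 2 + 1 / (2 * δ) - t = (δ * t - 1) ^ 2 / (2 * δ) := by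
      field_simp
      ring
    have : 0 ≤ (δ * t - 1) ^ 2 / (2 * δ) := by positivity
    linarith
  calc _ ≤ ∫⁻ θ in Set.Ioo (-π) π, ((∫⁻ s in Set.Ioc 0 δ, ENNReal.ofReal (δ / 2) *
          ENNReal.ofReal (h (x + s • unitDirection θ) ^ 2)) +
          ENNReal.ofReal (1 / (2 * δ)) * ENNReal.ofReal δ) := by
        gcongr with θ
        refine (lintegral_mono fun s ↦ hpt (h (x + s • unitDirection θ))).trans_eq ?_
        rw [lintegral_add_right _ measurable_const, setLIntegral_const, Real.volume_Ioc, sub_zero]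
    _ = _ := by
        rw [lintegral_add_right _ measurable_const, setLIntegral_const, Real.volume_Ioo]
        congr 1
        · rw [← lintegral_const_mul' _ _ ENNReal.ofReal_ne_top]
          congr with θ
          rw [lintegral_const_mul' _ _ ENNReal.ofReal_ne_top]
        · rw [← ENNReal.ofReal_mul (by positivity), ← ENNReal.ofReal_mul (by positivity)]
          congr 1
          field_simp
          ring

/-- Gaussian decay, with the sharp exponent `4 * π`, of the superlevel sets of `u`. -/
lemma volume_superlevel_le {u : EuclideanSpace ℝ (Fin 2) → ℝ} (hu : ContDiff ℝ 1 u) {M r : ℝ}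
    (hgrad : ∫⁻ x, ENNReal.ofReal (‖fderiv ℝ u x‖ ^ 2) ≤ 1)
    (hL2 : ∫⁻ x, ENNReal.ofReal (u x ^ 2) ≤ ENNReal.ofReal (M ^ 2)) (hr : 0 < r) :
    volume {x | (M ^ 2 / 2 + π * log 2 + 2 * π) / (2 * π) + r ≤ |u x|} ≤
      ENNReal.ofReal (4 * exp (-(4 * π * r ^ 2))) := by
  have hdir := continuous_unitDirection
  have huc := hu.continuous
  have hgc := hu.continuous_fderiv one_ne_zero
  set g : EuclideanSpace ℝ (Fin 2) → ℝ := fun x ↦ ‖fderiv ℝ u x‖ with hg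
  have hgcont : Continuous g := by fun_prop
  set δ := 2 * exp (-(2 * π * r ^ 2)) with hδ
  have hδ0 : 0 < δ := by positivity
  have hδ2 : δ ≤ 2 := by
    have : exp (-(2 * π * r ^ 2)) ≤ 1 := exp_le_one_iff.2 (by simp; positivity)
    linarith
  have hlog : log (2 / δ) = 2 * π * r ^ 2 := by
    rw [hδ, div_mul_cancel_left₀ two_ne_zero, ← exp_neg, log_exp, neg_neg]
  set Q : EuclideanSpace ℝ (Fin 2) → ENNReal := fun x ↦ ∫⁻ θ in Set.Ioo (-π) π,
    ∫⁻ s in Set.Ioc 0 δ, ENNReal.ofReal (g (x + s • unitDirection θ) ^ 2) with hQ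
  have hQmeas : Measurable Q :=
    measurable_lintegral_rays (f := fun y ↦ ENNReal.ofReal (g y ^ 2)) (by fun_prop) _
  have hQint : ∫⁻ x, Q x ≤ ENNReal.ofReal (2 * π * δ) := by
    rw [hQ, lintegral_lintegral_rays (f := fun y ↦ ENNReal.ofReal (g y ^ 2)) (by fun_prop),
      ENNReal.ofReal_mul (p := 2 * π) (by positivity), Real.volume_Ioc, sub_zero]
    gcongr
    exact mul_le_of_le_one_right' hgrad
  have hbound (x : EuclideanSpace ℝ (Fin 2)) : ENNReal.ofReal (2 * π * |u x|) ≤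
      ENNReal.ofReal (M ^ 2 / 2 + π * log 2 + 2 * π * r + π) + ENNReal.ofReal (δ / 2) * Q x := by
    have hfar : (∫⁻ θ in Set.Ioo (-π) π, ∫⁻ s in Set.Ioc (1 : ℝ) 2,
        ENNReal.ofReal |u (x + s • unitDirection θ)|) ≤
        ENNReal.ofReal (M ^ 2 / 2 + π * log 2) := by
      refine (lintegral_annulus_le huc.abs x one_pos one_le_two one_pos).trans ?_
      simp only [sq_abs, div_one]
      rw [ENNReal.ofReal_add (by positivity) (by positivity), div_eq_inv_mul (M ^ 2),
        ENNReal.ofReal_mul (p := 2⁻¹) (by positivity), one_div]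
      gcongr
    have hmid : (∫⁻ θ in Set.Ioo (-π) π, ∫⁻ s in Set.Ioc δ 2,
        ENNReal.ofReal (g (x + s • unitDirection θ))) ≤ ENNReal.ofReal (2 * π * r) := by
      refine (lintegral_annulus_le hgcont x hδ0 hδ2 (c := 2 * π * r) (by positivity)).trans ?_
      have : 2 * π * r = 2 * π * r / 2 + π / (2 * π * r) * log (2 / δ) := by
        rw [hlog]
        field_simp
        ring
      nth_rewrite 3 [this]
      rw [ENNReal.ofReal_add (by positivity) (by rw [hlog]; positivity)]
      gcongr
      exact mul_le_of_le_one_right' hgrad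
    have hsplit : (∫⁻ θ in Set.Ioo (-π) π, ∫⁻ s in Set.Ioc (0 : ℝ) 2,
        ENNReal.ofReal (g (x + s • unitDirection θ))) =
        (∫⁻ θ in Set.Ioo (-π) π, ∫⁻ s in Set.Ioc (0 : ℝ) δ,
          ENNReal.ofReal (g (x + s • unitDirection θ))) +
        ∫⁻ θ in Set.Ioo (-π) π, ∫⁻ s in Set.Ioc δ 2,
          ENNReal.ofReal (g (x + s • unitDirection θ)) := by
      rw [← lintegral_add_left]
      · congr with θ
        rw [← Set.Ioc_union_Ioc_eq_Ioc hδ0.le hδ2,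
          lintegral_union measurableSet_Ioc (Set.Ioc_disjoint_Ioc_of_le le_rfl)]
      · apply Measurable.lintegral_prod_right
        fun_prop
    refine (ofReal_abs_le_lintegral_rays hu x).trans ?_
    rw [hsplit, ENNReal.ofReal_add (by positivity) (by positivity),
      ENNReal.ofReal_add (by positivity) (by positivity)]
    calc _ ≤ _ := add_le_add hfar (add_le_add (lintegral_disc_le g x hδ0) hmid)
      _ = _ := by ring
  have hsubset : {x | (M ^ 2 / 2 + π * log 2 + 2 * π) / (2 * π) + r ≤ |u x|} ⊆
      {x | ENNReal.ofReal (2 * π / δ) ≤ Q x} := by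
    intro x hx
    simp only [Set.mem_ofPred_eq] at hx ⊢
    rcases eq_or_ne (Q x) ⊤ with htop | htop
    · simp [htop]
    apply ENNReal.ofReal_le_of_le_toReal
    have hb := hbound x
    rw [← ENNReal.ofReal_toReal htop, ← ENNReal.ofReal_mul (by positivity),
      ← ENNReal.ofReal_add (by positivity) (by positivity),
      ENNReal.ofReal_le_ofReal_iff (by positivity)] at hb
    rw [div_le_iff₀ hδ0]
    have hx' : M ^ 2 / 2 + π * log 2 + 2 * π + 2 * π * r ≤ 2 * π * |u x| := by
      calc _ = 2 * π * ((M ^ 2 / 2 + π * log 2 + 2 * π) / (2 * π) + r) := by field_simp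
        _ ≤ _ := by gcongr
    linarith
  calc _ ≤ volume {x | ENNReal.ofReal (2 * π / δ) ≤ Q x} := measure_mono hsubset
    _ ≤ (∫⁻ x, Q x) / ENNReal.ofReal (2 * π / δ) :=
      meas_ge_le_lintegral_div hQmeas.aemeasurable (by simp; positivity) ENNReal.ofReal_ne_top
    _ ≤ ENNReal.ofReal (2 * π * δ) / ENNReal.ofReal (2 * π / δ) := by gcongr
    _ = ENNReal.ofReal (4 * exp (-(4 * π * r ^ 2))) := by
      rw [← ENNReal.ofReal_div_of_pos (by positivity)]
      congr 1
      have : exp (-(4 * π * r ^ 2)) = exp (-(2 * π * r ^ 2)) ^ 2 := by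
        rw [← exp_nat_mul]
        congr 1
        push_cast
        ring
      rw [this, div_div_eq_mul_div, mul_assoc, mul_div_cancel_left₀ _ (by positivity), hδ]
      ring

lemma summable_exp_quadratic {a : ℝ} (ha : 0 < a) (b c : ℝ) :
    Summable fun k : ℕ ↦ exp (-a * k ^ 2 + b * k + c) := by
  refine Summable.of_nonneg_of_le (fun _ ↦ (exp_pos _).le) (fun k ↦ ?_)
    (Real.summable_exp_neg_nat.mul_left (exp (c + (b + 1) ^ 2 / (4 * a))))
  rw [← exp_add, exp_le_exp]
  have : c + (b + 1) ^ 2 / (4 * a) + -(k : ℝ) - (-a * k ^ 2 + b * k + c) =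
      (2 * a * k - (b + 1)) ^ 2 / (4 * a) := by
    field_simp
    ring
  have : 0 ≤ (2 * a * k - (b + 1)) ^ 2 / (4 * a) := by positivity
  linarith

/-- Slicing `exp (α * u ^ 2) - 1` along the integer levels of `u` above `N`. -/
lemma ofReal_exp_sub_one_le {α : ℝ} (hα : 0 ≤ α) (N : ℕ) (t : ℝ) :
    ENNReal.ofReal (exp (α * t ^ 2) - 1) ≤
      ENNReal.ofReal (α * exp (α * N ^ 2)) * ENNReal.ofReal (t ^ 2) +
      ∑' k : ℕ, {s : ℝ | (N + k : ℝ) ≤ |s|}.indicator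
        (fun _ ↦ ENNReal.ofReal (exp (α * (N + k + 1) ^ 2))) t := by
  rcases lt_or_ge |t| N with h | h
  · refine le_trans ?_ le_self_add
    rw [← ENNReal.ofReal_mul (by positivity)]
    apply ENNReal.ofReal_le_ofReal
    have h1 : exp (α * t ^ 2) - 1 ≤ α * t ^ 2 * exp (α * t ^ 2) := by
      have := add_one_le_exp (-(α * t ^ 2))
      have h2 : exp (-(α * t ^ 2)) * exp (α * t ^ 2) = 1 := by rw [← exp_add]; simp
      nlinarith [exp_pos (α * t ^ 2)]
    have h3 : t ^ 2 ≤ (N : ℝ) ^ 2 := by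
      rw [← sq_abs]
      gcongr
    calc _ ≤ _ := h1
      _ ≤ α * t ^ 2 * exp (α * N ^ 2) := by gcongr
      _ = _ := by ring
  · refine le_trans ?_ le_add_self
    have hN : N ≤ ⌊|t|⌋₊ := Nat.le_floor h
    obtain ⟨k, hk⟩ := Nat.exists_eq_add_of_le hN
    have hk' : ((⌊|t|⌋₊ : ℕ) : ℝ) = N + k := by exact_mod_cast hk
    refine le_trans ?_ (ENNReal.le_tsum k)
    rw [Set.indicator_of_mem]
    · apply ENNReal.ofReal_le_ofReal
      have h1 : |t| ≤ N + k + 1 := hk' ▸ (Nat.lt_floor_add_one |t|).le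
      have h2 : t ^ 2 ≤ (N + k + 1 : ℝ) ^ 2 := by
        rw [← sq_abs]
        gcongr
      have : exp (α * t ^ 2) ≤ exp (α * (N + k + 1) ^ 2) := by gcongr
      linarith
    · simp only [Set.mem_ofPred_eq, ← hk']
      exact Nat.floor_le (abs_nonneg t)

/-- Trudinger–Moser inequality for the whole plane ℝ² (Cao's version). -/
theorem trudinger_moser_whole_plane (M α : ℝ) (hM : 0 < M) (hα0 : 0 < α)
    (hα : α < 4 * Real.pi) :
    ∃ C > 0, ∀ u : EuclideanSpace ℝ (Fin 2) → ℝ, ContDiff ℝ 1 u → HasCompactSupport u →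
      (∫ x, ‖fderiv ℝ u x‖ ^ 2) ≤ 1 →
      (∫ x, (u x) ^ 2) ≤ M ^ 2 →
      (∫ x, (Real.exp (α * (u x) ^ 2) - 1)) ≤ C := by
  set B := (M ^ 2 / 2 + π * log 2 + 2 * π) / (2 * π) with hB
  obtain ⟨N, hN⟩ := exists_nat_gt B
  set w : ℕ → ℝ := fun k ↦
    exp (α * (N + k + 1) ^ 2) * (4 * exp (-(4 * π * (N + k - B) ^ 2))) with hw
  have hw0 (k : ℕ) : 0 ≤ w k := by positivity
  have hsum : Summable w := by
    refine ((summable_exp_quadratic (sub_pos.2 hα)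
      (2 * α * (N + 1) - 8 * π * (N - B)) (α * (N + 1) ^ 2 - 4 * π * (N - B) ^ 2)).mul_left 4).congr
      fun k ↦ ?_
    simp only [hw]
    rw [mul_left_comm, ← exp_add]
    congr 2
    ring
  have hwt : 0 ≤ ∑' k, w k := tsum_nonneg hw0
  refine ⟨α * exp (α * N ^ 2) * M ^ 2 + ∑' k, w k, by positivity, ?_⟩
  intro u hu hsupp hgrad hL2
  have huc := hu.continuous
  have hgrad' : ∫⁻ x, ENNReal.ofReal (‖fderiv ℝ u x‖ ^ 2) ≤ 1 := by
    have hgc := hu.continuous_fderiv one_ne_zero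
    rw [← ofReal_integral_eq_lintegral_ofReal _ (Filter.Eventually.of_forall fun _ ↦ by positivity)]
    · exact ENNReal.ofReal_le_one.2 hgrad
    · refine Continuous.integrable_of_hasCompactSupport (by fun_prop) ?_
      exact (hsupp.fderiv ℝ).comp_left (g := fun L ↦ ‖L‖ ^ 2) (by simp)
  have hL2' : ∫⁻ x, ENNReal.ofReal (u x ^ 2) ≤ ENNReal.ofReal (M ^ 2) := by
    rw [← ofReal_integral_eq_lintegral_ofReal _ (Filter.Eventually.of_forall fun _ ↦ by positivity)]
    · exact ENNReal.ofReal_le_ofReal hL2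
    · refine Continuous.integrable_of_hasCompactSupport (by fun_prop) ?_
      exact hsupp.comp_left (g := fun t ↦ t ^ 2) (by simp)
  have hlevel (k : ℕ) : MeasurableSet {x | (N + k : ℝ) ≤ |u x|} :=
    measurableSet_le measurable_const (by fun_prop)
  have hterm (k : ℕ) : ∫⁻ x, {s : ℝ | (N + k : ℝ) ≤ |s|}.indicator
      (fun _ ↦ ENNReal.ofReal (exp (α * (N + k + 1) ^ 2))) (u x) ≤ ENNReal.ofReal (w k) := by
    have hr : 0 < N + k - B := by
      have : (0 : ℝ) ≤ k := k.cast_nonneg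
      linarith
    have hv := volume_superlevel_le hu hgrad' hL2' hr
    rw [← hB, add_sub_cancel] at hv
    calc _ = ∫⁻ x, {x | (N + k : ℝ) ≤ |u x|}.indicator
          (fun _ ↦ ENNReal.ofReal (exp (α * (N + k + 1) ^ 2))) x := rfl
      _ ≤ _ := by
        rw [lintegral_indicator_const (hlevel k), hw, ENNReal.ofReal_mul (by positivity)]
        gcongr
  have hmain : ∫⁻ x, ENNReal.ofReal (exp (α * u x ^ 2) - 1) ≤
      ENNReal.ofReal (α * exp (α * N ^ 2) * M ^ 2 + ∑' k, w k) := by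
    refine (lintegral_mono fun x ↦ ofReal_exp_sub_one_le hα0.le N (u x)).trans ?_
    rw [lintegral_add_left (by fun_prop), lintegral_const_mul _ (by fun_prop), lintegral_tsum,
      ENNReal.ofReal_add (by positivity) hwt,
      ENNReal.ofReal_mul (p := α * exp (α * N ^ 2)) (by positivity),
      ENNReal.ofReal_tsum_of_nonneg hw0 hsum]
    · gcongr
      exact hterm _
    · exact fun k ↦ (measurable_const.indicator (hlevel k)).aemeasurable
  rw [integral_eq_lintegral_of_nonneg_ae]
  · exact ENNReal.toReal_le_of_le_ofReal (by positivity) hmain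
  · refine Filter.Eventually.of_forall fun x ↦ ?_
    simp only [Pi.zero_apply, sub_nonneg, one_le_exp_iff]
    positivity
  · exact Continuous.aestronglyMeasurable (by fun_prop)
end

section
/- For all real numbers r ≥ 0 and s ≥ 0 one has r·s ≤ (e^{r²} − 1) + s·(log⁺ s)^{1/2} + (1/4)·s²·𝟙_{[0, e^{1/4}]}(s), where log⁺ s = max(log s, 0) and 𝟙_{[0, e^{1/4}]}(s) equals 1 if 0 ≤ s ≤ e^{1/4} and 0 otherwise. -/
open Real Set

/-- Young-type inequality of do Ó–Ruf:
`r·s ≤ (e^{r²} − 1) + s·(log⁺ s)^{1/2} + (1/4)·s²·𝟙_{[0, e^{1/4}]}(s)`. -/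
theorem young_type_inequality (r s : ℝ) (hr : 0 ≤ r) (hs : 0 ≤ s) :
    r * s ≤ (Real.exp (r ^ 2) - 1) + s * (max (Real.log s) 0) ^ ((1 : ℝ) / 2)
      + (1 / 4) * s ^ 2 * Set.indicator (Set.Icc 0 (Real.exp (1 / 4))) (fun _ => (1 : ℝ)) s := by
  rw [← Real.sqrt_eq_rpow]
  by_cases h : s ≤ Real.exp (1 / 4)
  · rw [Set.indicator_of_mem (Set.mem_Icc.2 ⟨hs, h⟩)]
    have h1 := Real.add_one_le_exp (r ^ 2)
    have h2 : 0 ≤ s * √(max (Real.log s) 0) := by positivity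
    nlinarith [sq_nonneg (r - s / 2)]
  · rw [Set.indicator_of_notMem (fun hm => h hm.2)]
    push Not at h
    have hs0 : 0 < s := (Real.exp_pos _).trans h
    have hlog : 1 / 4 < Real.log s := (Real.lt_log_iff_exp_lt hs0).2 h
    rw [max_eq_left (by linarith)]
    set t := √(Real.log s)
    have ht2 : t ^ 2 = Real.log s := Real.sq_sqrt (by linarith)
    have ht_half : 1 / 2 ≤ t := Real.le_sqrt_of_sq_le (by linarith)
    rcases le_total r t with hrt | hrt
    · have h1 := Real.one_le_exp (sq_nonneg r)
      nlinarith
    · have hs1 : 1 ≤ s := (Real.one_le_exp (by norm_num)).trans h.le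
      have h1 : s * (r ^ 2 - t ^ 2 + 1) ≤ Real.exp (r ^ 2) := by
        calc s * (r ^ 2 - t ^ 2 + 1) ≤ s * Real.exp (r ^ 2 - t ^ 2) := by
              gcongr
              exact Real.add_one_le_exp _
          _ = Real.exp (r ^ 2) := by
              rw [Real.exp_sub, ht2, Real.exp_log hs0]
              field_simp
      have h2 : s * (r - t) ≤ s * (r ^ 2 - t ^ 2) :=
        mul_le_mul_of_nonneg_left (by nlinarith) hs
      linarith
end

section
/- Let p ≥ 1 be a real number. Then for all real numbers u, v and all s ≥ −1 one has |u|^{p−1}·u·((s²/2 + s)·u + (s + 1)·v) + |u|^{p+1}/(p+1) ≤ |(1 + s)·u + v|^{p+1}/(p+1). -/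
open Real

/-- Young's inequality for the exponents `(p + 1) / 2` and `(p + 1) / (p - 1)`, in a form that
includes `p = 1`. -/
lemma rpow_sub_one_mul_sq_le {p a b : ℝ} (hp : 1 ≤ p) (ha : 0 ≤ a) (hb : 0 ≤ b) :
    a ^ (p - 1) * b ^ 2 ≤ 2 / (p + 1) * b ^ (p + 1) + (p - 1) / (p + 1) * a ^ (p + 1) := by
  have hp1 : 0 < p + 1 := by linarith
  have h := Real.geom_mean_le_arith_mean2_weighted
    (by positivity : 0 ≤ 2 / (p + 1)) (div_nonneg (by linarith) hp1.le : 0 ≤ (p - 1) / (p + 1))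
    (rpow_nonneg hb (p + 1)) (rpow_nonneg ha (p + 1)) (by field_simp; ring)
  rw [← rpow_mul hb, ← rpow_mul ha, mul_div_cancel₀ _ hp1.ne', mul_div_cancel₀ _ hp1.ne',
    rpow_two] at h
  linarith

/-- Scalar core of the Szulkin–Weth inequality for the pure power nonlinearity. -/
theorem power_nonlinearity_inequality (p : ℝ) (hp : 1 ≤ p) (u v s : ℝ) (hs : -1 ≤ s) :
    |u| ^ (p - 1) * u * ((s ^ 2 / 2 + s) * u + (s + 1) * v) + |u| ^ (p + 1) / (p + 1)
      ≤ |(1 + s) * u + v| ^ (p + 1) / (p + 1) := by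
  have hp1 : 0 < p + 1 := by linarith
  have young := rpow_sub_one_mul_sq_le hp (abs_nonneg u) (abs_nonneg ((1 + s) * u + v))
  have hpow : |u| ^ (p + 1) = |u| ^ (p - 1) * u ^ 2 := by
    rw [← sq_abs u, ← rpow_two, ← rpow_add_of_nonneg (abs_nonneg u) (by linarith) (by norm_num)]
    congr 1
    ring
  rw [sq_abs] at young
  have hquad : u * ((s ^ 2 / 2 + s) * u + (s + 1) * v) ≤ (((1 + s) * u + v) ^ 2 - u ^ 2) / 2 := by
    nlinarith [sq_nonneg v]
  have hmul := mul_le_mul_of_nonneg_left hquad (rpow_nonneg (abs_nonneg u) (p - 1))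
  have hcoef : (p - 1) / (p + 1) * |u| ^ (p + 1)
      = |u| ^ (p + 1) - 2 * (|u| ^ (p + 1) / (p + 1)) := by
    field_simp
    ring
  have hcoef' : 2 / (p + 1) * |(1 + s) * u + v| ^ (p + 1)
      = 2 * (|(1 + s) * u + v| ^ (p + 1) / (p + 1)) := by
    ring
  linarith
end

section
/- Let N ≥ 3 be an integer, let 2* = 2N/(N−2), and let q be a real number with q > 1. Let W, h, k : ℝᴺ → ℝ be nonnegative functions. Define g(x,t) = W(x)t + h(x)|t|^{q−1}t + k(x)|t|^{2*−2}t and G(x,t) = W(x)t²/2 + h(x)|t|^{q+1}/(q+1) + k(x)|t|^{2*}/2*. Then for all x ∈ ℝᴺ, all u, v ∈ ℝ, and all s ≥ −1 one has g(x,u)·((s²/2 + s)·u + (s + 1)·v) + G(x,u) − G(x,(1+s)u + v) ≤ −W(x)·v²/2. -/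
open Real

/-- Young's inequality for the exponents `p / r` and `p / 2`, where `p = r + 2`. -/
theorem rpow_mul_sq_le {r : ℝ} (hr : 0 < r) {a b : ℝ} (ha : 0 ≤ a) (hb : 0 ≤ b) :
    a ^ r * b ^ 2 ≤ r / (r + 2) * a ^ (r + 2) + 2 / (r + 2) * b ^ (r + 2) := by
  have hp : r + 2 ≠ 0 := by positivity
  have h := geom_mean_le_arith_mean2_weighted (w₁ := r / (r + 2)) (w₂ := 2 / (r + 2))
    (by positivity) (by positivity) (rpow_nonneg ha (r + 2)) (rpow_nonneg hb (r + 2))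
    (by field_simp)
  rwa [← rpow_mul ha, ← rpow_mul hb, mul_div_cancel₀ _ hp, mul_div_cancel₀ _ hp,
    rpow_two] at h

/-- The integrand inequality for a single pure power nonlinearity `|t| ^ r * t`. -/
theorem power_integrand_nonpos {r : ℝ} (hr : 0 < r) (u v s : ℝ) :
    |u| ^ r * u * ((s ^ 2 / 2 + s) * u + (s + 1) * v) + |u| ^ (r + 2) / (r + 2)
      - |(1 + s) * u + v| ^ (r + 2) / (r + 2) ≤ 0 := by
  set z := (1 + s) * u + v with hz
  have young := rpow_mul_sq_le hr (abs_nonneg u) (abs_nonneg z)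
  have hsplit : |u| ^ (r + 2) = |u| ^ r * u ^ 2 := by
    rw [rpow_add_of_nonneg (abs_nonneg u) hr.le zero_le_two, rpow_two, sq_abs]
  have hquad : |u| ^ r * (u * ((s ^ 2 / 2 + s) * u + (s + 1) * v))
      ≤ |u| ^ r * (z ^ 2 / 2 - u ^ 2 / 2) := by
    gcongr
    rw [hz]
    nlinarith [sq_nonneg v]
  have hweight : r / (r + 2) * |u| ^ (r + 2)
      = |u| ^ (r + 2) - 2 * (|u| ^ (r + 2) / (r + 2)) := by
    field_simp
    ring
  have hcomm : 2 / (r + 2) * |z| ^ (r + 2) = 2 * (|z| ^ (r + 2) / (r + 2)) := by ring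
  rw [sq_abs, hweight, hcomm] at young
  linarith

/-- Pointwise integrand inequality underlying Lemma 2.1. -/
theorem integrand_inequality (N : ℕ) (hN : 3 ≤ N)
    (W h k : EuclideanSpace ℝ (Fin N) → ℝ) (q : ℝ) (hq : 1 < q)
    (hW : ∀ x, 0 ≤ W x) (hh : ∀ x, 0 ≤ h x) (hk : ∀ x, 0 ≤ k x)
    (g G : EuclideanSpace ℝ (Fin N) → ℝ → ℝ)
    (hg : ∀ x t, g x t = W x * t + h x * |t| ^ (q - 1) * t
        + k x * |t| ^ ((2 * N : ℝ) / ((N : ℝ) - 2) - 2) * t)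
    (hG : ∀ x t, G x t = W x * t ^ 2 / 2 + h x * |t| ^ (q + 1) / (q + 1)
        + k x * |t| ^ ((2 * N : ℝ) / ((N : ℝ) - 2)) / ((2 * N : ℝ) / ((N : ℝ) - 2))) :
    ∀ x, ∀ u v s : ℝ, -1 ≤ s →
      g x u * ((s ^ 2 / 2 + s) * u + (s + 1) * v) + G x u - G x ((1 + s) * u + v)
        ≤ -(W x) * v ^ 2 / 2 := by
  intro x u v s _
  have hN' : (0 : ℝ) < (N : ℝ) - 2 := by
    have : (3 : ℝ) ≤ N := by exact_mod_cast hN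
    linarith
  have hr : 0 < (2 * N : ℝ) / ((N : ℝ) - 2) - 2 := by
    have : (2 * N : ℝ) / ((N : ℝ) - 2) - 2 = 4 / ((N : ℝ) - 2) := by
      field_simp
      ring
    rw [this]
    positivity
  have h₁ := mul_nonpos_of_nonneg_of_nonpos (hh x)
    (power_integrand_nonpos (sub_pos.mpr hq) u v s)
  have h₂ := mul_nonpos_of_nonneg_of_nonpos (hk x) (power_integrand_nonpos hr u v s)
  rw [show q - 1 + 2 = q + 1 by ring] at h₁
  rw [sub_add_cancel] at h₂
  rw [hg, hG, hG]
  linear_combination h₁ + h₂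
end

section
/- Let f : ℝ² × ℝ → ℝ be a continuous function with f(x,t)·t ≥ 0 for all (x,t) ∈ ℝ² × ℝ. Let (u_n) be a sequence of measurable functions u_n : ℝ² → ℝ and u : ℝ² → ℝ a measurable function such that u_n(x) → u(x) for almost every x ∈ ℝ², each function x ↦ f(x,u_n(x))·u_n(x) is Lebesgue integrable on ℝ², and sup_n ∫_{ℝ²} f(x,u_n(x))·u_n(x) dx < ∞. Then for every R > 0 one has ∫_{B_R(0)} |f(x,u_n(x)) − f(x,u(x))| dx → 0 as n → ∞; in particular, ∫_{ℝ²} f(x,u_n(x)) φ(x) dx → ∫_{ℝ²} f(x,u(x)) φ(x) dx for every smooth compactly supported function φ : ℝ² → ℝ. -/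
open Real MeasureTheory Filter Topology

/-- If `f x t * t ≥ 0`, `f` is bounded for `t` in bounded sets, and `f x (u i x) * u i x` is bounded
in `L¹`, then the family `f x (u i x)` is uniformly integrable. -/
theorem uniformIntegrable_comp_of_integral_mul_self_le {X ι : Type*} [MeasurableSpace X]
    {μ : Measure X} [IsFiniteMeasure μ] {f : X → ℝ → ℝ} {u : ι → X → ℝ} {M : ℝ}
    (hsign : ∀ x t, 0 ≤ f x t * t)
    (hbound : ∀ T : ℝ, ∃ K : ℝ, ∀ᵐ x ∂μ, ∀ t, |t| ≤ T → |f x t| ≤ K)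
    (hmeas : ∀ i, AEStronglyMeasurable (fun x => f x (u i x)) μ)
    (hint : ∀ i, Integrable (fun x => f x (u i x) * u i x) μ)
    (hM : ∀ i, ∫ x, f x (u i x) * u i x ∂μ ≤ M) :
    UniformIntegrable (fun i x => f x (u i x)) 1 μ := by
  refine uniformIntegrable_of le_rfl ENNReal.one_ne_top hmeas fun ε hε => ?_
  set T : ℝ := (|M| + 1) / ε
  have hT : 0 < T := by positivity
  obtain ⟨K, hK⟩ := hbound T
  refine ⟨(|K| + 1).toNNReal, fun i => ?_⟩
  calc eLpNorm ({x | (|K| + 1).toNNReal ≤ ‖f x (u i x)‖₊}.indicator fun x => f x (u i x)) 1 μ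
      ≤ eLpNorm (fun x => T⁻¹ * (f x (u i x) * u i x)) 1 μ := by
        refine eLpNorm_mono_ae ?_
        filter_upwards [hK] with x hx
        by_cases h : x ∈ {x | (|K| + 1).toNNReal ≤ ‖f x (u i x)‖₊}
        · rw [Set.indicator_of_mem h]
          have h_large : |K| + 1 ≤ |f x (u i x)| := Real.toNNReal_le_iff_le_coe.mp h
          have hu : T ≤ |u i x| := by
            by_contra! hlt
            linarith [hx _ hlt.le, le_abs_self K]
          rw [Real.norm_eq_abs, Real.norm_eq_abs, abs_mul, abs_mul, abs_of_pos (inv_pos.mpr hT),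
            inv_mul_eq_div, le_div_iff₀ hT]
          gcongr
        · rw [Set.indicator_of_notMem h, norm_zero]
          exact norm_nonneg _
    _ = ENNReal.ofReal (T⁻¹ * ∫ x, f x (u i x) * u i x ∂μ) := by
        rw [eLpNorm_one_eq_lintegral_enorm,
          ← ofReal_integral_norm_eq_lintegral_enorm ((hint i).const_mul _), ← integral_const_mul]
        congr 2 with x
        exact Real.norm_of_nonneg (mul_nonneg (inv_pos.mpr hT).le (hsign _ _))
    _ ≤ ENNReal.ofReal ε := by
        refine ENNReal.ofReal_le_ofReal ?_
        rw [inv_mul_eq_div, div_le_iff₀ hT, mul_div_cancel₀ _ hε.ne']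
        linarith [hM i, le_abs_self M]

/-- Multiplication by a bounded function `φ` vanishing outside `s` preserves `L¹(s)` convergence
on the level of integrals. -/
theorem tendsto_integral_mul_of_tendsto_setIntegral_abs_sub {X : Type*} [MeasurableSpace X]
    {μ : Measure X} {s : Set X} {F : ℕ → X → ℝ} {G φ : X → ℝ} {C : ℝ}
    (hF : ∀ n, IntegrableOn (F n) s μ) (hG : IntegrableOn G s μ)
    (hφ : AEStronglyMeasurable φ (μ.restrict s)) (hC : ∀ x, ‖φ x‖ ≤ C)
    (hs : ∀ x, x ∉ s → φ x = 0)
    (h : Tendsto (fun n => ∫ x in s, |F n x - G x| ∂μ) atTop (𝓝 0)) :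
    Tendsto (fun n => ∫ x, F n x * φ x ∂μ) atTop (𝓝 (∫ x, G x * φ x ∂μ)) := by
  have h_restrict (H : X → ℝ) : ∫ x, H x * φ x ∂μ = ∫ x in s, H x * φ x ∂μ :=
    (setIntegral_eq_integral_of_forall_compl_eq_zero fun x hx => by simp [hs x hx]).symm
  have h_mul {H : X → ℝ} (hH : IntegrableOn H s μ) : IntegrableOn (fun x => H x * φ x) s μ :=
    hH.mul_bdd hφ (ae_of_all _ hC)
  simp_rw [h_restrict]
  rw [tendsto_iff_norm_sub_tendsto_zero]
  refine squeeze_zero (fun _ => norm_nonneg _) (fun n => ?_) (by simpa using h.mul_const C)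
  rw [← integral_sub (h_mul (hF n)) (h_mul hG), ← integral_mul_const]
  refine norm_integral_le_of_norm_le (((hF n).sub hG).abs.mul_const C) (ae_of_all _ fun x => ?_)
  rw [← sub_mul, norm_mul]
  exact mul_le_mul_of_nonneg_left (hC x) (norm_nonneg _)

/-- Compactness lemma (Lemma 3.4, after de Figueiredo–Miyagaki–Ruf): a.e.
convergence plus a uniform `L¹` bound on `f(x,uₙ)uₙ` gives local `L¹`
convergence of `f(x,uₙ)`, hence convergence against test functions. -/
theorem local_L1_convergence_of_nonlinearity
    (f : EuclideanSpace ℝ (Fin 2) → ℝ → ℝ)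
    (hfc : Continuous (Function.uncurry f))
    (hsign : ∀ x t, 0 ≤ f x t * t)
    (u : ℕ → EuclideanSpace ℝ (Fin 2) → ℝ) (v : EuclideanSpace ℝ (Fin 2) → ℝ)
    (humeas : ∀ n, Measurable (u n)) (hvmeas : Measurable v)
    (hae : ∀ᵐ x, Tendsto (fun n => u n x) atTop (nhds (v x)))
    (hint : ∀ n, Integrable (fun x => f x (u n x) * u n x))
    (hbdd : BddAbove (Set.range fun n => ∫ x, f x (u n x) * u n x)) :
    (∀ R > 0, Tendsto (fun n => ∫ x in Metric.ball (0 : EuclideanSpace ℝ (Fin 2)) R,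
        |f x (u n x) - f x (v x)|) atTop (nhds 0)) ∧
    ∀ φ : EuclideanSpace ℝ (Fin 2) → ℝ, ContDiff ℝ (⊤ : ℕ∞) φ → HasCompactSupport φ →
      Tendsto (fun n => ∫ x, f x (u n x) * φ x) atTop
        (nhds (∫ x, f x (v x) * φ x)) := by
  obtain ⟨M, hM⟩ := hbdd
  have h_meas {w : EuclideanSpace ℝ (Fin 2) → ℝ} (hw : Measurable w) :
      Measurable fun x => f x (w x) :=
    hfc.measurable.comp (measurable_id.prodMk hw)
  have h_lim : ∀ᵐ x, Tendsto (fun n => f x (u n x)) atTop (𝓝 (f x (v x))) := by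
    filter_upwards [hae] with x hx
    exact ((hfc.comp (Continuous.prodMk_right x)).tendsto (v x)).comp hx
  have h_ui (R : ℝ) : UniformIntegrable (fun n x => f x (u n x)) 1
      (volume.restrict (Metric.ball (0 : EuclideanSpace ℝ (Fin 2)) R)) := by
    have : IsFiniteMeasure (volume.restrict (Metric.ball (0 : EuclideanSpace ℝ (Fin 2)) R)) :=
      isFiniteMeasure_restrict.mpr measure_ball_lt_top.ne
    refine uniformIntegrable_comp_of_integral_mul_self_le (M := M) hsign (fun T => ?_)
      (fun n => (h_meas (humeas n)).aestronglyMeasurable) (fun n => (hint n).integrableOn)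
      fun n => ?_
    · obtain ⟨K, hK⟩ := ((isCompact_closedBall (0 : EuclideanSpace ℝ (Fin 2)) R).prod
        (isCompact_Icc (a := -T) (b := T))).exists_bound_of_continuousOn hfc.continuousOn
      refine ⟨K, ?_⟩
      filter_upwards [ae_restrict_mem measurableSet_ball] with x hx t ht
      exact hK (x, t) ⟨Metric.ball_subset_closedBall hx, abs_le.mp ht⟩
    · exact (setIntegral_le_integral (hint n) (ae_of_all _ fun x => hsign _ _)).trans
        (hM ⟨n, rfl⟩)
  have h_int (R : ℝ) (n : ℕ) :
      IntegrableOn (fun x => f x (u n x)) (Metric.ball 0 R) :=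
    memLp_one_iff_integrable.mp ((h_ui R).memLp n)
  have h_int_lim (R : ℝ) : IntegrableOn (fun x => f x (v x)) (Metric.ball 0 R) :=
    (h_ui R).integrable_of_ae_tendsto (ae_restrict_of_ae h_lim)
  have h_L1 (R : ℝ) : Tendsto (fun n => ∫ x in Metric.ball (0 : EuclideanSpace ℝ (Fin 2)) R,
      |f x (u n x) - f x (v x)|) atTop (𝓝 0) := by
    have : IsFiniteMeasure (volume.restrict (Metric.ball (0 : EuclideanSpace ℝ (Fin 2)) R)) :=
      isFiniteMeasure_restrict.mpr measure_ball_lt_top.ne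
    have h := tendsto_Lp_finite_of_tendsto_ae le_rfl ENNReal.one_ne_top (h_ui R).1
      (memLp_one_iff_integrable.mpr (h_int_lim R)) (h_ui R).2.1 (ae_restrict_of_ae h_lim)
    refine ((ENNReal.tendsto_toReal ENNReal.zero_ne_top).comp h).congr fun n => ?_
    rw [Function.comp_apply, eLpNorm_one_eq_lintegral_enorm,
      ← integral_norm_eq_lintegral_enorm ((h_int R n).sub (h_int_lim R)).1]
    rfl
  refine ⟨fun R _ => h_L1 R, fun φ hφ hφc => ?_⟩
  obtain ⟨C, hC⟩ := hφc.exists_bound_of_continuous hφ.continuous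
  obtain ⟨R, hR⟩ := hφc.isCompact.isBounded.subset_ball 0
  exact tendsto_integral_mul_of_tendsto_setIntegral_abs_sub (h_int R) (h_int_lim R)
    hφ.continuous.aestronglyMeasurable hC
    (fun x hx => image_eq_zero_of_notMem_tsupport fun hx' => hx (hR hx')) (h_L1 R)
end
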